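/- arXiv:1403.1627 — 6 statements merged into one kernel-verified Lean document; each statement's English description precedes it below -/
import Mathlib

section
/- Let X ⊆ ℝⁿ be a nonempty connected semi-analytic set, relatively closed in an open set U ⊆ ℝⁿ. If f ∈ C^∞(U,ℝ) is such that every first-order partial derivative ∂f/∂x_i (i = 1,…,n) belongs to 𝒥^∞(X,U), then there exists a constant c ∈ ℝ such that f − c ∈ 𝒥^∞(X,U). (This is the degree-zero part of the Whitney–de Rham Poincaré lemma: the zeroth Whitney–de Rham cohomology of a connected semi-analytic set is ℝ.) -/
noncomputable section

/-- A set `X ⊆ ℝⁿ` is semi-analytic if every point of `ℝⁿ` has an open neighborhood `V`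
and finitely many real-analytic functions `g i j`, `f i j : V → ℝ` such that
`X ∩ V = ⋃ i, {x ∈ V | g i j x = 0 ∧ f i j x > 0 for all j}`. -/
def SemiAnalytic {n : ℕ} (X : Set (EuclideanSpace ℝ (Fin n))) : Prop :=
  ∀ z : EuclideanSpace ℝ (Fin n), ∃ V : Set (EuclideanSpace ℝ (Fin n)), IsOpen V ∧ z ∈ V ∧
    ∃ (p q : ℕ) (g f : Fin p → Fin q → EuclideanSpace ℝ (Fin n) → ℝ),
      (∀ i j, AnalyticOnNhd ℝ (g i j) V) ∧ (∀ i j, AnalyticOnNhd ℝ (f i j) V) ∧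
      X ∩ V = ⋃ i : Fin p, {x | x ∈ V ∧ ∀ j : Fin q, g i j x = 0 ∧ 0 < f i j x}

/-- `JInf X U f` expresses that `f ∈ 𝒥^∞(X, U)`: the function `f` is smooth on `U` and all of its
(iterated) derivatives vanish at every point of `X`, i.e. `f` is flat on `X`. -/
def JInf {n : ℕ} (X U : Set (EuclideanSpace ℝ (Fin n)))
    (f : EuclideanSpace ℝ (Fin n) → ℝ) : Prop :=
  ContDiffOn ℝ (⊤ : ℕ∞) f U ∧ ∀ (k : ℕ), ∀ x ∈ X, iteratedFDerivWithin ℝ k f U x = 0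

section Flat

open Set Metric Topology Module
open scoped NNReal ENNReal ContDiff

variable {E F : Type*} [NormedAddCommGroup E] [NormedSpace ℝ E]
  [NormedAddCommGroup F] [NormedSpace ℝ F]

/-- If all derivatives of positive order of `f` vanish at `x` and the derivative of order `k + j + 1`
is bounded by `C` on a convex set `s ∋ x`, then the derivative of order `k` is within
`C * ‖y - x‖ ^ (j + 1)` of its value at `x`. -/
theorem norm_iteratedFDerivWithin_sub_le_of_flat {U s : Set E} {f : E → F} {C : ℝ} {x : E}
    (hU : UniqueDiffOn ℝ U) (hf : ContDiffOn ℝ ∞ f U) (hs : Convex ℝ s) (hsU : s ⊆ U)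
    (hx : x ∈ s) (hflat : ∀ k, iteratedFDerivWithin ℝ (k + 1) f U x = 0) (hC : 0 ≤ C)
    (j k : ℕ) (hbound : ∀ z ∈ s, ‖iteratedFDerivWithin ℝ (k + j + 1) f U z‖ ≤ C)
    {y : E} (hy : y ∈ s) :
    ‖iteratedFDerivWithin ℝ k f U y - iteratedFDerivWithin ℝ k f U x‖ ≤ C * ‖y - x‖ ^ (j + 1) := by
  have hderiv : ∀ z ∈ s, HasFDerivWithinAt (iteratedFDerivWithin ℝ k f U)
      (fderivWithin ℝ (iteratedFDerivWithin ℝ k f U) U z) s z := fun z hz =>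
    ((hf.differentiableOn_iteratedFDerivWithin (mod_cast ENat.natCast_lt_top k) hU) z
      (hsU hz)).hasFDerivWithinAt.mono hsU
  induction j generalizing k y with
  | zero =>
    simpa using hs.norm_image_sub_le_of_norm_hasFDerivWithin_le hderiv
      (fun z hz => by simpa [norm_fderivWithin_iteratedFDerivWithin] using hbound z hz) hx hy
  | succ j ih =>
    have hbound' : ∀ z ∈ s, ‖iteratedFDerivWithin ℝ (k + 1 + j + 1) f U z‖ ≤ C := by
      rwa [show k + 1 + j + 1 = k + (j + 1) + 1 by omega]
    have hderiv' : ∀ z ∈ s, HasFDerivWithinAt (iteratedFDerivWithin ℝ (k + 1) f U)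
        (fderivWithin ℝ (iteratedFDerivWithin ℝ (k + 1) f U) U z) s z := fun z hz =>
      ((hf.differentiableOn_iteratedFDerivWithin (mod_cast ENat.natCast_lt_top (k + 1)) hU) z
        (hsU hz)).hasFDerivWithinAt.mono hsU
    have hle : ∀ z ∈ segment ℝ x y,
        ‖fderivWithin ℝ (iteratedFDerivWithin ℝ k f U) U z‖ ≤ C * ‖y - x‖ ^ (j + 1) := by
      intro z hz
      have hzs := hs.segment_subset hx hy hz
      have h := ih (k + 1) hbound' hzs hderiv'
      rw [hflat, sub_zero] at h
      rw [norm_fderivWithin_iteratedFDerivWithin]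
      have hzy : ‖z - x‖ ≤ ‖y - x‖ := norm_sub_le_of_mem_segment hz
      exact h.trans (by gcongr)
    calc _ ≤ C * ‖y - x‖ ^ (j + 1) * ‖y - x‖ :=
          (convex_segment x y).norm_image_sub_le_of_norm_hasFDerivWithin_le
            (fun z hz => (hderiv z (hs.segment_subset hx hy hz)).mono
              (hs.segment_subset hx hy)) hle (left_mem_segment ℝ x y) (right_mem_segment ℝ x y)
      _ = C * ‖y - x‖ ^ (j + 1 + 1) := by ring

/-- A smooth function whose derivatives of positive order all vanish on `X` is locally Hölder on `X`
of every positive integer exponent. -/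
theorem exists_holderOnWith_of_flat {U X : Set E} {f : E → F} (hU : IsOpen U) (hXU : X ⊆ U)
    (hf : ContDiffOn ℝ ∞ f U)
    (hflat : ∀ k, ∀ x ∈ X, iteratedFDerivWithin ℝ (k + 1) f U x = 0) (m : ℕ) {x : E}
    (hx : x ∈ X) :
    ∃ C : ℝ≥0, ∃ t ∈ 𝓝[X] x, HolderOnWith C ((m + 1 : ℕ) : ℝ≥0) f t := by
  have hxU : U ∈ 𝓝 x := hU.mem_nhds (hXU hx)
  have hcont : ContinuousAt (iteratedFDerivWithin ℝ (m + 1) f U) x :=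
    (hf.continuousOn_iteratedFDerivWithin (mod_cast le_top) hU.uniqueDiffOn).continuousAt hxU
  have hev : ∀ᶠ z in 𝓝 x, ‖iteratedFDerivWithin ℝ (m + 1) f U z‖ < 1 :=
    hcont.norm.eventually_lt_const (by simp [hflat m x hx])
  obtain ⟨r, hr, hball⟩ := Metric.mem_nhds_iff.1 (Filter.inter_mem hxU hev)
  refine ⟨1, X ∩ ball x r, inter_mem_nhdsWithin X (ball_mem_nhds x hr), ?_⟩
  intro y hy z hz
  have h := norm_iteratedFDerivWithin_sub_le_of_flat (C := 1) hU.uniqueDiffOn hf (convex_ball x r)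
    (fun w hw => (hball hw).1) hz.2 (fun k => hflat k z hz.1) zero_le_one m 0
    (fun w hw => by rw [zero_add]; exact (hball hw).2.le) hy.2
  rw [iteratedFDerivWithin_zero_eq_comp, Function.comp_apply, Function.comp_apply, ← map_sub,
    LinearIsometryEquiv.norm_map, one_mul, ← dist_eq_norm, ← dist_eq_norm] at h
  rw [ENNReal.coe_one, one_mul, NNReal.coe_natCast, ENNReal.rpow_natCast, edist_dist, edist_dist,
    ← ENNReal.ofReal_pow dist_nonneg]
  exact ENNReal.ofReal_le_ofReal h

/-- A smooth real function whose derivatives of positive order all vanish on a preconnected set `X`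
is constant on `X`: its image on `X` has Hausdorff dimension less than one. -/
theorem IsPreconnected.eq_of_flat [FiniteDimensional ℝ E] {U X : Set E} {f : E → ℝ}
    (hX : IsPreconnected X) (hU : IsOpen U) (hXU : X ⊆ U) (hf : ContDiffOn ℝ ∞ f U)
    (hflat : ∀ k, ∀ x ∈ X, iteratedFDerivWithin ℝ (k + 1) f U x = 0) {x y : E}
    (hx : x ∈ X) (hy : y ∈ X) : f x = f y := by
  by_contra hne
  have hdim : dimH (f '' X) ≤ dimH X / ((finrank ℝ E + 1 : ℕ) : ℝ≥0) :=
    dimH_image_le_of_locally_holder_on (by positivity)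
      fun z hz => exists_holderOnWith_of_flat hU hXU hf hflat _ hz
  have hXdim : dimH X ≤ finrank ℝ E :=
    (dimH_mono (subset_univ X)).trans_eq (Real.dimH_univ_eq_finrank E)
  have hlt : dimH (f '' X) < 1 := by
    refine hdim.trans_lt ((ENNReal.div_lt_iff (by simp) (by simp)).2 ?_)
    rw [one_mul]
    exact hXdim.trans_lt (mod_cast Nat.lt_succ_self _)
  have hseg : segment ℝ (f x) (f y) ⊆ f '' X :=
    (hX.image f (hf.continuousOn.mono hXU)).ordConnected.convex.segment_subset
      (mem_image_of_mem f hx) (mem_image_of_mem f hy)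
  exact ((Real.dimH_segment hne).symm.trans_le (dimH_mono hseg)).not_gt hlt

/-- The derivatives of positive order of `f` vanish at `x` if all derivatives of its partial
derivatives along a basis vanish at `x`. -/
theorem iteratedFDerivWithin_succ_eq_zero_of_basis {ι : Type*} (b : Basis ι ℝ E) {U : Set E}
    {f : E → F} (hU : UniqueDiffOn ℝ U) (hf : ContDiffOn ℝ ∞ f U) {x : E} (hx : x ∈ U) {k : ℕ}
    (h : ∀ i, iteratedFDerivWithin ℝ k (fun z => fderivWithin ℝ f U z (b i)) U x = 0) :
    iteratedFDerivWithin ℝ (k + 1) f U x = 0 := by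
  rw [← norm_eq_zero, ← norm_iteratedFDerivWithin_fderivWithin hU hx, norm_eq_zero]
  ext1 m
  refine ContinuousLinearMap.coe_injective (b.ext fun i => ?_)
  have hd : ContDiffOn ℝ ∞ (fderivWithin ℝ f U) U := hf.fderivWithin hU le_rfl
  have hcomp := (ContinuousLinearMap.apply ℝ F (b i)).iteratedFDerivWithin_comp_left (hd x hx) hU hx
    (i := k) (mod_cast le_top)
  exact congrArg (fun M => M m) (hcomp.symm.trans (h i))

end Flat

/-- Degree-zero Whitney–de Rham Poincaré lemma: if `X` is a nonempty connected semi-analytic set,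
relatively closed in the open set `U`, and `f ∈ C^∞(U)` has all first-order partial derivatives
in `𝒥^∞(X, U)`, then `f - c ∈ 𝒥^∞(X, U)` for some constant `c`. -/
theorem degree_zero_whitney_poincare {n : ℕ} (X U : Set (EuclideanSpace ℝ (Fin n)))
    (hU : IsOpen U) (hXU : X ⊆ U) (hrc : closure X ∩ U = X)
    (hne : X.Nonempty) (hconn : IsConnected X) (hsa : SemiAnalytic X)
    (f : EuclideanSpace ℝ (Fin n) → ℝ) (hf : ContDiffOn ℝ (⊤ : ℕ∞) f U)
    (hpart : ∀ i : Fin n,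
      JInf X U (fun x => fderivWithin ℝ f U x (EuclideanSpace.single i 1))) :
    ∃ c : ℝ, JInf X U (fun x => f x - c) := by
  have hflat : ∀ k, ∀ x ∈ X, iteratedFDerivWithin ℝ (k + 1) f U x = 0 := fun k x hx =>
    iteratedFDerivWithin_succ_eq_zero_of_basis (EuclideanSpace.basisFun (Fin n) ℝ).toBasis
      hU.uniqueDiffOn hf (hXU hx) fun i => by simpa using (hpart i).2 k x hx
  obtain ⟨x₀, hx₀⟩ := hne
  refine ⟨f x₀, hf.sub contDiffOn_const, fun k x hx => ?_⟩
  cases k with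
  | zero =>
    ext m
    simp [hconn.isPreconnected.eq_of_flat hU hXU hf hflat hx hx₀]
  | succ k =>
    have hd : fderivWithin ℝ (fun z => f z - f x₀) U = fderivWithin ℝ f U := by
      ext1 z
      exact fderivWithin_sub_const (f x₀)
    rw [← norm_eq_zero, ← norm_iteratedFDerivWithin_fderivWithin hU.uniqueDiffOn (hXU hx), hd,
      norm_iteratedFDerivWithin_fderivWithin hU.uniqueDiffOn (hXU hx), hflat k x hx, norm_zero]
end
end

section
/- Let U, V ⊆ ℝⁿ be open, let π : V → U be a proper surjective real-analytic map, let A ⊆ U be a nonempty relatively closed semi-analytic subset of U, and set B = π⁻¹(A). Suppose π restricts to a bijection from V ∖ B onto U ∖ A whose inverse s : U ∖ A → V ∖ B is real-analytic. Then the pullback map f ↦ f ∘ π restricts to an ℝ-algebra isomorphism from 𝒥^∞(A,U) onto 𝒥^∞(B,V). -/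
noncomputable section

section

open Filter Topology Set
open scoped BoundedContinuousFunction

theorem FormalMultilinearSeries.analyticAt_tsum {F Y : Type*} [NormedAddCommGroup F]
    [NormedSpace ℝ F] [NormedAddCommGroup Y] [NormedSpace ℝ Y] [CompleteSpace Y]
    {q : ℕ → FormalMultilinearSeries ℝ F Y} {r : NNReal} (hr : 0 < r)
    (h : Summable fun kl : ℕ × ℕ => ‖q kl.1 kl.2‖ * (r : ℝ) ^ kl.2) :
    AnalyticAt ℝ (fun x => ∑' k, (q k).sum x) 0 := by
  have h' : Summable fun lk : ℕ × ℕ => ‖q lk.2 lk.1‖ * (r : ℝ) ^ lk.1 :=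
    h.prod_symm
  have hk : ∀ l, Summable fun k => ‖q k l‖ := fun l => by
    have := (h'.prod_factor l).mul_right (((r : ℝ) ^ l)⁻¹)
    refine this.congr fun k => ?_
    have : (r : ℝ) ^ l ≠ 0 := by positivity
    field_simp
  let Q : FormalMultilinearSeries ℝ F Y := fun l => ∑' k, q k l
  refine ⟨Q, r, ?_, by exact_mod_cast hr, ?_⟩
  · refine Q.le_radius_of_summable_norm ?_
    refine h'.prod.of_nonneg_of_le (fun l => by positivity) fun l => ?_
    refine le_of_le_of_eq ?_ (tsum_mul_right (f := fun k => ‖q k l‖) (a := (r : ℝ) ^ l)).symm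
    gcongr
    exact norm_tsum_le_tsum_norm (hk l)
  · intro y hy
    have hy' : ‖y‖ ≤ r := by
      have : ‖y‖ < r := by simpa using hy
      exact this.le
    have hs : Summable fun lk : ℕ × ℕ => q lk.2 lk.1 fun _ => y := by
      refine .of_norm_bounded h' fun lk => ?_
      refine ((q lk.2 lk.1).le_opNorm _).trans ?_
      simp only [Finset.prod_const, Finset.card_univ, Fintype.card_fin]
      gcongr
    have e1 : ∀ l, Q l (fun _ => y) = ∑' k, q k l fun _ => y := fun l => by
      have := (hk l).of_norm
      exact ((ContinuousMultilinearMap.apply ℝ (fun _ : Fin l => F) Y fun _ => y).map_tsum this)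
    simp only [zero_add, e1]
    have h1 := hs.prod.hasSum
    have h2 := Summable.tsum_comm (f := fun l k => q k l fun _ => y) hs
    rw [← hs.tsum_prod, hs.tsum_prod, ← h2] at h1
    exact h1

theorem AnalyticAt.exists_coeff_expansion {F : Type*} [NormedAddCommGroup F]
    [NormedSpace ℝ F] {f : F × ℝ → ℝ} (hf : AnalyticAt ℝ f 0) :
    ∃ (c : ℕ → F → ℝ) (ρ : ℝ), 0 < ρ ∧
      (∀ (Y : Type) [NormedAddCommGroup Y] [NormedSpace ℝ Y] [CompleteSpace Y] (u : ℕ → Y),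
        (∀ k, ‖u k‖ ≤ 1) → AnalyticAt ℝ (fun x => ∑' k, (c k x * ρ ^ k) • u k) 0) ∧
      ∀ᶠ x in 𝓝 (0 : F), (Summable fun k => |c k x| * ρ ^ k) ∧
        ∀ t, |t| ≤ ρ → HasSum (fun k => c k x * t ^ k) (f (x, t)) := by
  obtain ⟨p, R, hp⟩ := hf
  obtain ⟨ρ', hρ'0, hρ'⟩ := ENNReal.lt_iff_exists_nnreal_btwn.1 hp.r_pos
  set ρ : NNReal := ρ' / 3 with hρdef
  have hρ0 : 0 < ρ := by
    have : 0 < ρ' := by exact_mod_cast hρ'0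
    positivity
  have hρR : ((ρ + ρ : NNReal) : ENNReal) < R := by
    refine lt_of_le_of_lt ?_ hρ'
    have : ρ + ρ ≤ ρ' := by
      rw [← NNReal.coe_le_coe]; push_cast [hρdef]
      linarith [ρ'.coe_nonneg]
    exact_mod_cast this
  have hρrad : ((ρ : ENNReal) + ρ) < p.radius := by
    have := hρR.trans_le hp.r_le
    push_cast at this
    exact this
  let e : F × ℝ := (0, 1)
  have hc : ∀ x : F, ‖(x, (0 : ℝ))‖ = ‖x‖ := fun x => by simp [Prod.norm_def]
  have he : ‖e‖ = 1 := by simp [e, Prod.norm_def]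
  let c : ℕ → F → ℝ := fun k x => p.changeOrigin (x, 0) k fun _ => e
  have hS : Summable fun kl : ℕ × ℕ => ‖p.changeOriginSeries kl.1 kl.2‖ * (ρ : ℝ) ^ kl.2 * ρ ^ kl.1 := by
    have h1 := NNReal.summable_sigma.1 (p.changeOriginSeries_summable_aux₁ hρrad)
    have h3 : ∀ k l, ‖p.changeOriginSeries k l‖₊ * ρ ^ l * ρ ^ k ≤
        ∑' _ : { s : Finset (Fin (k + l)) // s.card = l }, ‖p (k + l)‖₊ * ρ ^ l * ρ ^ k := by
      intro k l
      rw [NNReal.tsum_mul_right, NNReal.tsum_mul_right]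
      gcongr
      exact p.nnnorm_changeOriginSeries_le_tsum k l
    have h4 := fun k => NNReal.summable_sigma.1 (h1.1 k)
    have h5 : ∀ k, Summable fun l => ‖p.changeOriginSeries k l‖₊ * ρ ^ l * ρ ^ k := fun k =>
      NNReal.summable_of_le (h3 k) (h4 k).2
    have h6 : Summable fun k => ∑' l, ‖p.changeOriginSeries k l‖₊ * ρ ^ l * ρ ^ k := by
      refine NNReal.summable_of_le (fun k => ?_) h1.2
      rw [NNReal.summable_of_le (fun _ => le_rfl) (h1.1 k) |>.tsum_sigma' (h4 k).1]
      exact (h5 k).tsum_le_tsum (h3 k) (h4 k).2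
    refine (summable_prod_of_nonneg fun _ => by positivity).2 ⟨fun k => ?_, ?_⟩
    · simpa using NNReal.summable_coe.2 (h5 k)
    · simpa [NNReal.coe_tsum] using NNReal.summable_coe.2 h6
  refine ⟨c, ρ, hρ0, ?_, ?_⟩
  · intro Y _ _ _ u hu
    let Λ : ∀ k : ℕ, ((F × ℝ) [×k]→L[ℝ] ℝ) →L[ℝ] Y := fun k =>
      ((ρ : ℝ) ^ k) • (ContinuousLinearMap.toSpanSingleton ℝ (u k)) ∘L
        (ContinuousMultilinearMap.apply ℝ (fun _ : Fin k => F × ℝ) ℝ fun _ => e)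
    have hΛ : ∀ k A, ‖Λ k A‖ ≤ ρ ^ k * ‖A‖ := by
      intro k A
      have h1 : ‖A fun _ => e‖ ≤ ‖A‖ := by
        simpa [he] using A.le_opNorm fun _ => e
      simp only [Λ, _root_.smul_apply, ContinuousLinearMap.comp_apply,
        ContinuousMultilinearMap.apply_apply, ContinuousLinearMap.toSpanSingleton_apply, norm_smul]
      have h2 := hu k
      have : ‖A fun _ => e‖ * ‖u k‖ ≤ ‖A‖ * 1 := by gcongr
      simpa using mul_le_mul_of_nonneg_left this (by positivity : (0 : ℝ) ≤ ‖(ρ : ℝ) ^ k‖)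
    let q : ℕ → FormalMultilinearSeries ℝ F Y := fun k =>
      (Λ k).compFormalMultilinearSeries
        ((p.changeOriginSeries k).compContinuousLinearMap (ContinuousLinearMap.inl ℝ F ℝ))
    have hq : ∀ k l, ‖q k l‖ ≤ ρ ^ k * ‖p.changeOriginSeries k l‖ := by
      intro k l
      refine ContinuousMultilinearMap.opNorm_le_bound (by positivity) fun v => ?_
      refine (hΛ k _).trans ?_
      rw [mul_assoc]
      gcongr
      refine ((p.changeOriginSeries k l).le_opNorm _).trans ?_
      simp [hc]
    have := FormalMultilinearSeries.analyticAt_tsum (q := q) hρ0 <| by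
      refine .of_nonneg_of_le (fun _ => by positivity) (fun kl => ?_) hS
      calc _ ≤ ρ ^ kl.1 * ‖p.changeOriginSeries kl.1 kl.2‖ * (ρ : ℝ) ^ kl.2 := by
            gcongr; exact hq _ _
        _ = _ := by ring
    refine this.congr ?_
    filter_upwards [Metric.ball_mem_nhds (0 : F) (NNReal.coe_pos.2 hρ0)] with x hx
    have hx : ‖(x, (0 : ℝ))‖ < ρ := by simpa [hc] using hx
    congr 1
    ext k
    have hsum : Summable fun l => p.changeOriginSeries k l fun _ => (x, (0 : ℝ)) := by
      have h1 : Summable fun l => ‖p.changeOriginSeries k l‖ * (ρ : ℝ) ^ l := by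
        have := (hS.prod_factor k).mul_right (((ρ : ℝ) ^ k)⁻¹)
        refine this.congr fun l => ?_
        have : (ρ : ℝ) ^ k ≠ 0 := by positivity
        field_simp
      refine .of_norm_bounded h1 fun l => ?_
      refine ((p.changeOriginSeries k l).le_opNorm _).trans ?_
      simp only [Finset.prod_const, Finset.card_univ, Fintype.card_fin]
      gcongr
    have h2 := (Λ k).map_tsum hsum
    calc (q k).sum x = ∑' l, Λ k (p.changeOriginSeries k l fun _ => (x, (0 : ℝ))) := rfl
      _ = Λ k (p.changeOrigin (x, 0) k) := h2.symm
      _ = (c k x * ρ ^ k) • u k := by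
        simp [Λ, c, smul_smul, mul_comm]
  · filter_upwards [Metric.ball_mem_nhds (0 : F) (NNReal.coe_pos.2 hρ0)] with x hx
    have hx : ‖(x, (0 : ℝ))‖ < ρ := by simpa [hc] using hx
    have hx' : ‖(x, (0 : ℝ))‖₊ < ρ := hx
    have hxR : (‖(x, (0 : ℝ))‖₊ : ENNReal) < R := 
      lt_of_le_of_lt (by exact_mod_cast hx'.le.trans (le_add_of_nonneg_right ρ.2)) hρR
    have H := hp.changeOrigin hxR
    have hrad : (ρ : ENNReal) < R - ‖(x, (0 : ℝ))‖₊ := by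
      rw [lt_tsub_iff_right]
      refine lt_of_le_of_lt ?_ hρR
      exact_mod_cast add_le_add_right hx'.le ρ
    refine ⟨?_, fun t ht => ?_⟩
    · have := (p.changeOrigin (x, 0)).summable_norm_mul_pow (hrad.trans_le H.r_le)
      refine .of_nonneg_of_le (fun _ => by positivity) (fun k => ?_) this
      gcongr
      simpa [he] using (p.changeOrigin (x, 0) k).le_opNorm fun _ => e
    · have hy : ((0 : F), t) ∈ Metric.eball (0 : F × ℝ) (R - ‖(x, (0 : ℝ))‖₊) := by
        rw [mem_eball_zero_iff]
        refine lt_of_le_of_lt ?_ hrad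
        rw [enorm_le_coe, ← NNReal.coe_le_coe]
        simpa [Prod.norm_def] using ht
      have := H.hasSum hy
      simp only [zero_add, Prod.mk_add_mk, add_zero] at this
      convert! this using 2 with k
      have h1 : ((0 : F), t) = t • e := by simp [e]
      rw [h1, ContinuousMultilinearMap.map_smul_univ]
      simp [c, mul_comm]

/-- Multiplication by the variable on power series with bounded coefficients. -/
def boundedSeqShift : (ℕ →ᵇ ℝ) →L[ℝ] (ℕ →ᵇ ℝ) :=
  LinearMap.mkContinuous
    { toFun := fun b => BoundedContinuousFunction.ofNormedAddCommGroupDiscrete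
        (fun k => Nat.casesOn k 0 fun j => b j) ‖b‖ (by
          rintro (_ | j)
          · simp
          · exact b.norm_coe_le_norm j)
      map_add' := fun a b => by ext (_ | j) <;> simp
      map_smul' := fun a b => by ext (_ | j) <;> simp }
    1 (fun b => by
      rw [one_mul]
      refine (BoundedContinuousFunction.norm_le (norm_nonneg _)).2 ?_
      rintro (_ | j)
      · simp
      · exact b.norm_coe_le_norm j)

@[simp] theorem boundedSeqShift_zero (b : ℕ →ᵇ ℝ) : boundedSeqShift b 0 = 0 := rfl

@[simp] theorem boundedSeqShift_succ (b : ℕ →ᵇ ℝ) (k : ℕ) :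
    boundedSeqShift b (k + 1) = b k := rfl

theorem norm_boundedSeqShift_le : ‖boundedSeqShift‖ ≤ 1 :=
  LinearMap.mkContinuous_norm_le _ zero_le_one _

/-- The left inverse of `boundedSeqShift` which forgets the constant coefficient. -/
def boundedSeqUnshift : (ℕ →ᵇ ℝ) →L[ℝ] (ℕ →ᵇ ℝ) :=
  LinearMap.mkContinuous
    { toFun := fun b => BoundedContinuousFunction.ofNormedAddCommGroupDiscrete
        (fun k => b (k + 1)) ‖b‖ (fun j => b.norm_coe_le_norm _)
      map_add' := fun a b => by ext j; simp
      map_smul' := fun a b => by ext j; simp }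
    1 (fun b => by
      rw [one_mul]
      refine (BoundedContinuousFunction.norm_le (norm_nonneg _)).2 fun j => ?_
      exact b.norm_coe_le_norm _)

@[simp] theorem boundedSeqUnshift_apply (b : ℕ →ᵇ ℝ) (k : ℕ) :
    boundedSeqUnshift b k = b (k + 1) := rfl

theorem norm_boundedSeqUnshift_le : ‖boundedSeqUnshift‖ ≤ 1 :=
  LinearMap.mkContinuous_norm_le _ zero_le_one _

theorem boundedSeqUnshift_pow_apply (b : ℕ →ᵇ ℝ) (d k : ℕ) :
    (boundedSeqUnshift ^ d) b k = b (k + d) := by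
  induction d generalizing k with
  | zero => simp
  | succ d ih =>
    rw [pow_succ', mul_apply_eq_comp, boundedSeqUnshift_apply, ih]
    congr 1; omega

theorem boundedSeqShift_pow_apply_of_lt (b : ℕ →ᵇ ℝ) {d k : ℕ} (h : k < d) :
    (boundedSeqShift ^ d) b k = 0 := by
  induction d generalizing k with
  | zero => simp at h
  | succ d ih =>
    rw [pow_succ', mul_apply_eq_comp]
    rcases k with _ | k
    · simp
    · rw [boundedSeqShift_succ, ih (by omega)]

theorem boundedSeqShift_pow_apply_add (b : ℕ →ᵇ ℝ) (d k : ℕ) :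
    (boundedSeqShift ^ d) b (k + d) = b k := by
  induction d generalizing k with
  | zero => simp
  | succ d ih =>
    rw [pow_succ', mul_apply_eq_comp, ← add_assoc, boundedSeqShift_succ, ih]

theorem summable_boundedSeq_mul_pow (b : ℕ →ᵇ ℝ) {τ : ℝ} (hτ : |τ| < 1) :
    Summable fun k => b k * τ ^ k := by
  refine .of_norm_bounded ((summable_geometric_of_lt_one (abs_nonneg τ) hτ).mul_left ‖b‖)
    fun k => ?_
  rw [norm_mul, norm_pow, Real.norm_eq_abs τ]
  gcongr
  exact b.norm_coe_le_norm k

/-- Evaluation at `τ` of power series with bounded coefficients (zero unless `|τ| < 1`). -/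
def boundedSeqEval (τ : ℝ) : (ℕ →ᵇ ℝ) →L[ℝ] ℝ :=
  if hτ : |τ| < 1 then
    LinearMap.mkContinuous
      { toFun := fun b => ∑' k, b k * τ ^ k
        map_add' := fun a b => by
          simp only [BoundedContinuousFunction.coe_add, Pi.add_apply, add_mul]
          exact (summable_boundedSeq_mul_pow a hτ).tsum_add (summable_boundedSeq_mul_pow b hτ)
        map_smul' := fun a b => by
          simp [mul_assoc, tsum_mul_left] }
      ((1 - |τ|)⁻¹) (fun b => by
        rw [← tsum_geometric_of_lt_one (abs_nonneg τ) hτ, ← tsum_mul_right]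
        refine tsum_of_norm_bounded
          (((summable_geometric_of_lt_one (abs_nonneg τ) hτ).mul_right ‖b‖).hasSum) fun k => ?_
        rw [norm_mul, norm_pow, Real.norm_eq_abs τ, mul_comm]
        gcongr
        exact b.norm_coe_le_norm k)
  else 0

theorem boundedSeqEval_apply {τ : ℝ} (hτ : |τ| < 1) (b : ℕ →ᵇ ℝ) :
    boundedSeqEval τ b = ∑' k, b k * τ ^ k := by
  rw [boundedSeqEval, dif_pos hτ]; rfl

theorem norm_boundedSeqEval_le {τ : ℝ} (hτ : |τ| ≤ 1 / 2) : ‖boundedSeqEval τ‖ ≤ 2 := by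
  rw [boundedSeqEval, dif_pos (by linarith)]
  refine (LinearMap.mkContinuous_norm_le _ (by rw [inv_nonneg]; linarith) _).trans ?_
  rw [inv_le_comm₀ (by linarith) (by norm_num)]
  linarith

theorem boundedSeqEval_eq_add {τ : ℝ} (hτ : |τ| < 1) (b : ℕ →ᵇ ℝ) :
    boundedSeqEval τ b = b 0 + τ * boundedSeqEval τ (boundedSeqUnshift b) := by
  rw [boundedSeqEval_apply hτ, boundedSeqEval_apply hτ,
    (summable_boundedSeq_mul_pow b hτ).tsum_eq_zero_add, ← tsum_mul_left]
  simp only [boundedSeqUnshift_apply, pow_zero, mul_one, pow_succ]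
  congr 2
  ext k
  ring

theorem boundedSeqEval_shift {τ : ℝ} (hτ : |τ| < 1) (b : ℕ →ᵇ ℝ) :
    boundedSeqEval τ (boundedSeqShift b) = τ * boundedSeqEval τ b := by
  rw [boundedSeqEval_eq_add hτ, boundedSeqShift_zero, zero_add]
  rfl

theorem boundedSeqEval_shift_pow {τ : ℝ} (hτ : |τ| < 1) (b : ℕ →ᵇ ℝ) (d : ℕ) :
    boundedSeqEval τ ((boundedSeqShift ^ d) b) = τ ^ d * boundedSeqEval τ b := by
  induction d with
  | zero => simp
  | succ d ih =>
    rw [pow_succ', mul_apply_eq_comp, boundedSeqEval_shift hτ, ih]; ring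

theorem boundedSeqEval_eq_sum_add {τ : ℝ} (hτ : |τ| < 1) (b : ℕ →ᵇ ℝ) (d : ℕ) :
    boundedSeqEval τ b = ∑ i ∈ Finset.range d, b i * τ ^ i +
      τ ^ d * boundedSeqEval τ ((boundedSeqUnshift ^ d) b) := by
  induction d with
  | zero => simp
  | succ d ih =>
    rw [ih, boundedSeqEval_eq_add hτ ((boundedSeqUnshift ^ d) b), Finset.sum_range_succ,
      pow_succ' boundedSeqUnshift, mul_apply_eq_comp, boundedSeqUnshift_pow_apply]
    simp only [zero_add]
    ring

/-- The preparation theorem, relative to an abstract space `X` of power series in one variable: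
`S` is the multiplication by the variable, `L` its left inverse, `coeff` and `ev` are the
coefficients and the evaluations. -/
theorem AnalyticAt.exists_weierstrass_polynomial_aux {F : Type*} [NormedAddCommGroup F]
    [NormedSpace ℝ F] {X : Type} [NormedAddCommGroup X] [NormedSpace ℝ X] [CompleteSpace X]
    {S L : ℕ → X →L[ℝ] X} (coeff : ℕ → X →L[ℝ] ℝ) (ev : ℝ → X →L[ℝ] ℝ) (one : X)
    (hSk : ∀ k, ‖S k‖ ≤ 1) (hLk : ∀ k, ‖L k‖ ≤ 1)
    (hSlt : ∀ b d k, k < d → coeff k ((S d) b) = 0)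
    (hSadd : ∀ d, coeff d ((S d) one) = 1)
    (hLadd : ∀ b d, coeff 0 ((L d) b) = coeff d b)
    (hevnorm : ∀ τ, |τ| ≤ 1 / 2 → ‖ev τ‖ ≤ 2)
    (hevone : ∀ τ, |τ| ≤ 1 / 2 → ev τ one = 1)
    (hevS : ∀ τ, |τ| ≤ 1 / 2 → ∀ b d, ev τ ((S d) b) = τ ^ d * ev τ b)
    (hevL : ∀ τ, |τ| ≤ 1 / 2 → ∀ b d, ev τ b =
      ∑ i ∈ Finset.range d, coeff i b * τ ^ i + τ ^ d * ev τ ((L d) b))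
    {f : F × ℝ → ℝ} (hf : AnalyticAt ℝ f 0) (h0 : ¬ ∀ᶠ t in 𝓝 (0 : ℝ), f (0, t) = 0) :
    ∃ (d : ℕ) (b : ℕ → F → ℝ) (C : ℝ), (∀ i, AnalyticAt ℝ (b i) 0) ∧
      ∀ᶠ z in 𝓝 (0 : F × ℝ),
        |z.2 ^ d + ∑ i ∈ Finset.range d, b i z.1 * z.2 ^ i| ≤ C * |f z| ∧
        (z.2 ^ d + ∑ i ∈ Finset.range d, b i z.1 * z.2 ^ i = 0 → f z = 0) := by
  obtain ⟨c, ρ, hρ, hc, hev⟩ := hf.exists_coeff_expansion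
  have hne : ∃ k, c k 0 ≠ 0 := by
    by_contra! hall
    refine h0 ?_
    filter_upwards [Metric.closedBall_mem_nhds (0 : ℝ) hρ] with t ht
    have := hev.self_of_nhds.2 t (by simpa using ht)
    simpa [hall] using this.tsum_eq.symm
  classical
  let d := Nat.find hne
  have hd : c d 0 ≠ 0 := Nat.find_spec hne
  have hlt : ∀ k < d, c k 0 = 0 := fun k hk => by simpa using Nat.find_min hne hk
  have hsum := hev.self_of_nhds.1
  set T := ∑' k, |c k 0| * ρ ^ k with hT
  have hT0 : 0 ≤ T := tsum_nonneg fun k => by positivity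
  obtain ⟨σ, hσ0, hσ1, hσT⟩ : ∃ σ : ℝ, 0 < σ ∧ σ ≤ 1 ∧ σ * T < |c d 0| * ρ ^ d := by
    have hpos : 0 < |c d 0| * ρ ^ d := by positivity
    refine ⟨min 1 (|c d 0| * ρ ^ d / (T + 1)), by positivity, min_le_left _ _, ?_⟩
    calc _ ≤ (|c d 0| * ρ ^ d / (T + 1)) * T := by gcongr; exact min_le_right _ _
      _ < _ := by
        rw [div_mul_eq_mul_div, div_lt_iff₀ (by positivity)]
        nlinarith
  set κ := c d 0 * (ρ * σ) ^ d with hκ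
  have hκ0 : κ ≠ 0 := by positivity
  let u : ℕ → (X →L[ℝ] X) := fun k => (σ ^ k) • S k
  have hu : ∀ k, ‖u k‖ ≤ 1 := fun k => by
    rw [norm_smul, norm_pow, Real.norm_of_nonneg hσ0.le]
    exact mul_le_one₀ (pow_le_one₀ hσ0.le hσ1) (norm_nonneg _) (hSk k)
  let M : F → (X →L[ℝ] X) := fun x => κ⁻¹ • ∑' k, (c k x * ρ ^ k) • u k
  have hM : AnalyticAt ℝ M 0 := (hc (X →L[ℝ] X) u hu).fun_const_smul
  have hMsum : ∀ x, (Summable fun k => |c k x| * ρ ^ k) → Summable fun k => (c k x * ρ ^ k) • u k :=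
    fun x hx => by
      refine .of_norm_bounded hx fun k => ?_
      rw [norm_smul, norm_mul, norm_pow, Real.norm_of_nonneg hρ.le, Real.norm_eq_abs]
      exact mul_le_of_le_one_right (by positivity) (hu k)
  let Ψ : F → (X →L[ℝ] X) := fun x => M x * L d + (1 - S d * L d)
  have hΨ : AnalyticAt ℝ Ψ 0 := (hM.fun_mul analyticAt_const).fun_add analyticAt_const
  have hRsum : HasSum (fun k => (κ⁻¹ * (if k = d then 0 else c k 0) * ρ ^ k) • u k)
      (M 0 - S d) := by
    have h1 := (hMsum 0 hsum).hasSum.const_smul κ⁻¹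
    have h2 := h1.sub (hasSum_ite_eq d (S d))
    convert! h2 using 2 with k
    split_ifs with hk
    · subst hk
      have e1 : κ⁻¹ * (c d 0 * ρ ^ d * σ ^ d) = 1 := by
        rw [mul_assoc, ← mul_pow, ← hκ, inv_mul_cancel₀ hκ0]
      simp only [u, smul_smul, e1, one_smul, sub_self, mul_zero, zero_mul, zero_smul]
    · simp only [u, sub_zero, smul_smul]
      congr 1
      ring
  set R := M 0 - S d with hR
  have hRnorm : ‖R‖ < 1 := by
    have h1 : ∀ k, ‖(κ⁻¹ * (if k = d then 0 else c k 0) * ρ ^ k) • u k‖ ≤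
        |κ|⁻¹ * σ ^ (d + 1) * (|c k 0| * ρ ^ k) := by
      intro k
      rcases lt_trichotomy k d with hk | rfl | hk
      · simp [hk.ne, hlt k hk]
      · simp only [if_true, mul_zero, zero_mul, zero_smul, norm_zero]
        positivity
      · simp only [hk.ne', if_false, u, norm_smul, norm_mul, norm_pow, norm_inv,
          Real.norm_eq_abs, abs_of_pos hσ0, abs_of_pos hρ]
        have h2 : σ ^ k * ‖S k‖ ≤ σ ^ (d + 1) * 1 :=
          mul_le_mul (pow_le_pow_of_le_one hσ0.le hσ1 hk) (hSk k) (norm_nonneg _) (by positivity)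
        calc _ = |κ|⁻¹ * |c k 0| * ρ ^ k * (σ ^ k * ‖S k‖) := by ring
          _ ≤ |κ|⁻¹ * |c k 0| * ρ ^ k * (σ ^ (d + 1) * 1) := by gcongr
          _ = _ := by ring
    have h2 := tsum_of_norm_bounded (hsum.hasSum.mul_left (|κ|⁻¹ * σ ^ (d + 1))) h1
    rw [hRsum.tsum_eq] at h2
    refine h2.trans_lt ?_
    have h3 : |κ| = |c d 0| * ρ ^ d * σ ^ d := by
      rw [hκ, abs_mul, abs_of_pos (by positivity : 0 < (ρ * σ) ^ d), mul_pow, mul_assoc]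
    have h4 : 0 < |κ| := abs_pos.2 hκ0
    rw [mul_assoc, inv_mul_lt_iff₀ h4, mul_one, h3, ← hT, pow_succ, mul_assoc, mul_comm (σ ^ d)]
    gcongr
  have hRd : ∀ z, coeff d (R z) = 0 := by
    intro z
    have h1 := ((coeff d) ∘L (ContinuousLinearMap.apply ℝ X z)).hasSum hRsum
    refine h1.unique ?_
    convert! (hasSum_zero : HasSum (fun _ : ℕ => (0 : ℝ)) 0) using 2 with k
    rcases lt_trichotomy k d with hk | rfl | hk
    · simp [hk.ne, hlt k hk]
    · simp
    · simp [u, hk.ne', hSlt z k d hk]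
  have hΨ0 : Ψ 0 = 1 + R * L d := by
    simp only [Ψ, hR, sub_mul]; abel
  have hunit : IsUnit (Ψ 0) := by
    rw [hΨ0, ← sub_neg_eq_add]
    refine isUnit_one_sub_of_norm_lt_one ?_
    rw [norm_neg]
    refine (norm_mul_le _ _).trans_lt ?_
    exact (mul_le_of_le_one_right (norm_nonneg _) (hLk d)).trans_lt hRnorm
  let w : F → X := fun x => Ring.inverse (Ψ x) ((S d) one)
  have hw : AnalyticAt ℝ w 0 := by
    obtain ⟨v, hv⟩ := hunit
    have h1 := analyticAt_inverse (𝕜 := ℝ) v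
    rw [hv] at h1
    exact ((ContinuousLinearMap.apply ℝ X ((S d) one)).analyticAt _).comp (h1.comp hΨ)
  have hΨw : ∀ᶠ x in 𝓝 0, Ψ x (w x) = (S d) one := by
    filter_upwards [hΨ.continuousAt.eventually (Units.isOpen.mem_nhds hunit)] with x hx
    have := Ring.mul_inverse_cancel _ hx
    exact DFunLike.congr_fun this ((S d) one)
  have hw0 : coeff d (w 0) = 1 := by
    have h1 := hΨw.self_of_nhds
    rw [hΨ0] at h1
    have h2 := congrArg (coeff d) h1
    simpa [hRd, hSadd] using h2
  have hMev : ∀ᶠ x in 𝓝 (0 : F), ∀ τ, |τ| ≤ 1 / 2 → ∀ z,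
      ev τ (M x z) = κ⁻¹ * f (x, ρ * σ * τ) * ev τ z := by
    filter_upwards [hev] with x hx τ hτ z
    have h1 := ((ev τ) ∘L (ContinuousLinearMap.apply ℝ X z)).hasSum
      ((hMsum x hx.1).hasSum.const_smul κ⁻¹)
    refine h1.unique ?_
    have h2 := ((hx.2 (ρ * σ * τ) ?_).mul_left κ⁻¹).mul_right (ev τ z)
    · convert! h2 using 2 with k
      simp [u, hevS τ hτ]
      ring
    · rw [abs_mul, abs_mul, abs_of_pos hρ, abs_of_pos hσ0, mul_assoc]
      refine mul_le_of_le_one_right hρ.le ?_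
      refine mul_le_one₀ hσ1 (abs_nonneg _) (by linarith)
  -- the final identity, in the rescaled variable
  have hid : ∀ᶠ x in 𝓝 (0 : F), ∀ τ, |τ| ≤ 1 / 2 →
      τ ^ d - ∑ i ∈ Finset.range d, coeff i (w x) * τ ^ i =
        κ⁻¹ * f (x, ρ * σ * τ) * ev τ ((L d) (w x)) := by
    filter_upwards [hMev, hΨw] with x h1 h2 τ hτ
    have h3 := congrArg (ev τ) h2
    have h4 := hevL τ hτ (w x) d
    simp only [Ψ, _root_.add_apply, _root_.sub_apply, mul_apply_eq_comp, map_add, map_sub,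
      h1 τ hτ, hevS τ hτ, hevone τ hτ, one_apply_eq_self] at h3
    linarith
  have hρσ : 0 < ρ * σ := by positivity
  refine ⟨d, fun i x => -((ρ * σ) ^ d / (ρ * σ) ^ i * coeff i (w x)),
    (ρ * σ) ^ d * (|κ|⁻¹ * (2 * (‖w 0‖ + 1))), fun i => ?_, ?_⟩
  · exact (analyticAt_const.mul (((coeff i).analyticAt _).comp hw)).neg
  have hwcont : ContinuousAt (fun z : F × ℝ => w z.1) 0 :=
    ContinuousAt.comp (f := Prod.fst) (g := w) hw.continuousAt continuousAt_fst
  have e1 : ∀ᶠ z in 𝓝 (0 : F × ℝ), ‖w z.1‖ < ‖w 0‖ + 1 :=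
    hwcont.norm.eventually_lt_const (by simp)
  have e2 : ∀ᶠ z in 𝓝 (0 : F × ℝ), 1 / 2 < coeff d (w z.1) := by
    refine Tendsto.eventually_const_lt ?_ ((coeff d).continuous.continuousAt.comp hwcont)
    simp only [Function.comp, Prod.fst_zero, hw0]; norm_num
  have e3 : ∀ᶠ z in 𝓝 (0 : F × ℝ), |z.2 / (ρ * σ)| < min (1 / 2) (1 / (8 * (‖w 0‖ + 1))) := by
    refine Tendsto.eventually_lt_const ?_
      (continuousAt_snd.div_const (ρ * σ)).abs
    simp; positivity
  have e4 := (continuousAt_fst (p := (0 : F × ℝ))).eventually hid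
  filter_upwards [e1, e2, e3, e4] with ⟨x, t⟩ h1 h2 h3 h4
  simp only at h1 h2 h3 h4 ⊢
  set τ := t / (ρ * σ) with hτdef
  have hτ : |τ| ≤ 1 / 2 := h3.le.trans (min_le_left _ _)
  have htτ : t = ρ * σ * τ := by rw [hτdef]; field_simp
  have h5 := h4 τ hτ
  rw [← htτ] at h5
  have h6 : t ^ d + ∑ i ∈ Finset.range d, -((ρ * σ) ^ d / (ρ * σ) ^ i * coeff i (w x)) * t ^ i =
      (ρ * σ) ^ d * (κ⁻¹ * f (x, t) * ev τ ((L d) (w x))) := by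
    rw [← h5, mul_sub, Finset.mul_sum, sub_eq_add_neg, ← Finset.sum_neg_distrib, ← mul_pow, ← htτ]
    congr 1
    refine Finset.sum_congr rfl fun i _ => ?_
    rw [htτ]
    field_simp
    ring
  have h7 : ‖(L d) (w x)‖ ≤ ‖w 0‖ + 1 :=
    ((L d).le_opNorm _).trans
      ((mul_le_of_le_one_left (norm_nonneg _) (hLk d)).trans h1.le)
  have h8 : |ev τ ((L d) (w x))| ≤ 2 * (‖w 0‖ + 1) :=
    ((ev τ).le_opNorm _).trans (mul_le_mul (hevnorm τ hτ) h7 (norm_nonneg _) (by norm_num))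
  rw [h6]
  constructor
  · rw [abs_mul, abs_mul, abs_mul, abs_inv, abs_of_pos (by positivity : 0 < (ρ * σ) ^ d)]
    calc (ρ * σ) ^ d * (|κ|⁻¹ * |f (x, t)| * |ev τ ((L d) (w x))|)
        ≤ (ρ * σ) ^ d * (|κ|⁻¹ * |f (x, t)| * (2 * (‖w 0‖ + 1))) := by gcongr
      _ = _ := by ring
  · intro h
    have h9 : ev τ ((L d) (w x)) ≠ 0 := by
      have h10 := hevL τ hτ ((L d) (w x)) 1
      simp only [Finset.sum_range_one, pow_zero, mul_one, hLadd] at h10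
      have h11 : ‖L 1 ((L d) (w x))‖ ≤ ‖w 0‖ + 1 := by
        refine ((L 1).le_opNorm _).trans ?_
        have := hLk 1
        exact (mul_le_of_le_one_left (norm_nonneg _) this).trans h7
      have h12 : |ev τ (L 1 ((L d) (w x)))| ≤ 2 * (‖w 0‖ + 1) :=
        ((ev τ).le_opNorm _).trans (mul_le_mul (hevnorm τ hτ) h11 (norm_nonneg _) (by norm_num))
      have h13 : |τ * ev τ (L 1 ((L d) (w x)))| ≤ 1 / 4 := by
        rw [abs_mul]
        calc _ ≤ 1 / (8 * (‖w 0‖ + 1)) * (2 * (‖w 0‖ + 1)) := by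
              gcongr
              exact h3.le.trans (min_le_right _ _)
          _ = _ := by field_simp; norm_num
      have := (abs_le.1 h13).1
      intro h14
      linarith
    have : (ρ * σ) ^ d ≠ 0 := by positivity
    rcases mul_eq_zero.1 h with h | h
    · exact absurd h this
    · rcases mul_eq_zero.1 h with h | h
      · rcases mul_eq_zero.1 h with h | h
        · exact absurd h (inv_ne_zero hκ0)
        · exact h
      · exact absurd h h9

/-- A preparation theorem: near a point where `f` does not vanish identically along the last
coordinate axis, `f` is bounded below by a monic polynomial in the last variable, with analytic
coefficients, all of whose zeros are zeros of `f`. -/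
theorem AnalyticAt.exists_weierstrass_polynomial {F : Type*} [NormedAddCommGroup F]
    [NormedSpace ℝ F] {f : F × ℝ → ℝ} (hf : AnalyticAt ℝ f 0)
    (h0 : ¬ ∀ᶠ t in 𝓝 (0 : ℝ), f (0, t) = 0) :
    ∃ (d : ℕ) (b : ℕ → F → ℝ) (C : ℝ), (∀ i, AnalyticAt ℝ (b i) 0) ∧
      ∀ᶠ z in 𝓝 (0 : F × ℝ),
        |z.2 ^ d + ∑ i ∈ Finset.range d, b i z.1 * z.2 ^ i| ≤ C * |f z| ∧
        (z.2 ^ d + ∑ i ∈ Finset.range d, b i z.1 * z.2 ^ i = 0 → f z = 0) := by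
  have hpow : ∀ A : (ℕ →ᵇ ℝ) →L[ℝ] (ℕ →ᵇ ℝ), ‖A‖ ≤ 1 → ∀ k, ‖A ^ k‖ ≤ 1 := by
    intro A hA k
    induction k with
    | zero => exact ContinuousLinearMap.norm_id_le
    | succ k ih =>
      rw [pow_succ]
      exact (ContinuousLinearMap.opNorm_comp_le _ _).trans (mul_le_one₀ ih (norm_nonneg _) hA)
  let one : ℕ →ᵇ ℝ := BoundedContinuousFunction.ofNormedAddCommGroupDiscrete
    (fun k => if k = 0 then 1 else 0) 1 (by intro k; split_ifs <;> simp)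
  refine AnalyticAt.exists_weierstrass_polynomial_aux (S := fun k => boundedSeqShift ^ k)
    (L := fun k => boundedSeqUnshift ^ k) (fun k => BoundedContinuousFunction.evalCLM ℝ k)
    boundedSeqEval one (hpow _ norm_boundedSeqShift_le) (hpow _ norm_boundedSeqUnshift_le)
    (fun b d k hk => boundedSeqShift_pow_apply_of_lt b hk)
    (fun d => ?_) (fun b d => ?_) (fun τ hτ => norm_boundedSeqEval_le hτ) (fun τ hτ => ?_)
    (fun τ hτ b d => boundedSeqEval_shift_pow (by linarith) b d)
    (fun τ hτ b d => boundedSeqEval_eq_sum_add (by linarith) b d) hf h0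
  · have := boundedSeqShift_pow_apply_add one d 0
    rw [zero_add] at this
    exact this
  · have := boundedSeqUnshift_pow_apply b d 0
    rw [zero_add] at this
    exact this
  · rw [boundedSeqEval_apply (by linarith), tsum_eq_single 0]
    · simp [one]
    · intro k hk
      simp [one, hk]

/-- The symmetric function of `τ` which sums, over all sets of `r` indices, the products of the
differences of the corresponding entries. -/
def subdiscriminant {d : ℕ} (r : ℕ) (τ : Fin d → ℂ) : ℂ :=
  ∑ S ∈ Finset.powersetCard r Finset.univ, ∏ p ∈ S.offDiag, (τ p.1 - τ p.2)

theorem exists_subdiscriminant_eq_aeval_esymm (d r : ℕ) :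
    ∃ Q : MvPolynomial (Fin d) ℝ, ∀ τ : Fin d → ℂ,
      MvPolynomial.aeval (fun i : Fin d => (Finset.univ.val.map τ).esymm (i + 1)) Q =
        subdiscriminant r τ := by
  classical
  let W : MvPolynomial (Fin d) ℝ := ∑ S ∈ Finset.powersetCard r Finset.univ,
    ∏ p ∈ S.offDiag, (MvPolynomial.X p.1 - MvPolynomial.X p.2)
  have hW : W.IsSymmetric := by
    intro e
    simp only [W, map_sum, map_prod, map_sub, MvPolynomial.rename_X]
    refine Finset.sum_bij (fun S _ => S.map e.toEmbedding) ?_ ?_ ?_ ?_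
    · intro S hS
      simpa [Finset.mem_powersetCard] using hS
    · intro S _ S' _ h
      exact Finset.map_injective _ h
    · intro S hS
      refine ⟨S.map e.symm.toEmbedding, by simpa [Finset.mem_powersetCard] using hS, ?_⟩
      ext; simp
    · intro S _
      refine Finset.prod_bij (fun p _ => (e p.1, e p.2)) ?_ ?_ ?_ ?_
      · rintro ⟨a, b⟩ h
        simpa [Finset.mem_offDiag] using h
      · rintro ⟨a, b⟩ _ ⟨a', b'⟩ _ h
        simpa using h
      · rintro ⟨a, b⟩ h
        refine ⟨(e.symm a, e.symm b), ?_, by simp⟩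
        simpa [Finset.mem_offDiag] using h
      · rintro ⟨a, b⟩ _
        rfl
  obtain ⟨Q, hQ⟩ := MvPolynomial.esymmAlgHom_surjective (R := ℝ) (σ := Fin d) (n := d)
    (by simp) ⟨W, hW⟩
  refine ⟨Q, fun τ => ?_⟩
  have h1 := congrArg (fun w : MvPolynomial.symmetricSubalgebra (Fin d) ℝ =>
    MvPolynomial.aeval τ (w : MvPolynomial (Fin d) ℝ)) hQ
  simp only [MvPolynomial.esymmAlgHom_apply] at h1
  have h2 := MvPolynomial.comp_aeval_apply
    (fun i : Fin d => MvPolynomial.esymm (Fin d) ℝ (i + 1)) (MvPolynomial.aeval (R := ℝ) τ) Q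
  rw [h1] at h2
  simp only [MvPolynomial.aeval_esymm_eq_multiset_esymm] at h2
  rw [← h2]
  simp [W, subdiscriminant]

/-- `τ` lists the complex roots of the real monic polynomial of degree `d` with coefficients `b`. -/
def IsRootList {d : ℕ} (b : ℕ → ℝ) (τ : Fin d → ℂ) : Prop :=
  ∀ t : ℂ, t ^ d + ∑ i ∈ Finset.range d, (b i : ℂ) * t ^ i = ∏ i, (t - τ i)

/-- The monic polynomial of degree `d` with lower coefficients `b`. -/
def monicPoly (d : ℕ) (b : ℕ → ℝ) : Polynomial ℂ :=
  Polynomial.X ^ d + ∑ i ∈ Finset.range d, Polynomial.C (b i : ℂ) * Polynomial.X ^ i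

theorem degree_sum_lt_monicPoly (d : ℕ) (b : ℕ → ℝ) :
    (∑ i ∈ Finset.range d, Polynomial.C (b i : ℂ) * Polynomial.X ^ i).degree < (d : WithBot ℕ) := by
  refine lt_of_le_of_lt (Polynomial.degree_sum_le (Finset.range d)
    fun i => Polynomial.C (b i : ℂ) * Polynomial.X ^ i) ?_
  refine (Finset.sup_lt_iff (WithBot.bot_lt_coe d)).2 ?_
  intro i hi
  exact (Polynomial.degree_C_mul_X_pow_le _ _).trans_lt (WithBot.coe_lt_coe.2 (Finset.mem_range.1 hi))

theorem monicPoly_monic (d : ℕ) (b : ℕ → ℝ) : (monicPoly d b).Monic :=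
  Polynomial.monic_X_pow_add (degree_sum_lt_monicPoly d b)

theorem natDegree_monicPoly (d : ℕ) (b : ℕ → ℝ) : (monicPoly d b).natDegree = d :=
  Polynomial.natDegree_eq_of_degree_eq_some (by
    rw [monicPoly, Polynomial.degree_add_eq_left_of_degree_lt]
    · simp
    · simpa using degree_sum_lt_monicPoly d b)

theorem coeff_monicPoly {d : ℕ} (b : ℕ → ℝ) {k : ℕ} (hk : k < d) :
    (monicPoly d b).coeff k = b k := by
  simp [monicPoly, Polynomial.coeff_X_pow, hk.ne, hk]

theorem eval_monicPoly (d : ℕ) (b : ℕ → ℝ) (t : ℂ) : (monicPoly d b).eval t =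
    t ^ d + ∑ i ∈ Finset.range d, (b i : ℂ) * t ^ i := by
  simp [monicPoly, Polynomial.eval_finsetSum]

theorem exists_isRootList (d : ℕ) (b : ℕ → ℝ) : ∃ τ : Fin d → ℂ, IsRootList b τ := by
  have hs := IsAlgClosed.splits (monicPoly d b)
  have hc : Multiset.card (monicPoly d b).roots = d := by
    rw [← hs.natDegree_eq_card_roots, natDegree_monicPoly]
  obtain ⟨l, hl⟩ := Quot.exists_rep (monicPoly d b).roots
  have hl' : (l : Multiset ℂ) = (monicPoly d b).roots := hl
  have hlen : l.length = d := by rw [← hc, ← hl']; rfl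
  subst hlen
  refine ⟨l.get, fun t => ?_⟩
  have h1 := hs.eq_prod_roots_of_monic (monicPoly_monic _ b)
  rw [← eval_monicPoly, h1, ← hl', Polynomial.eval_multiset_prod]
  simp [Multiset.map_coe, ← List.prod_ofFn, Function.comp_def]

theorem IsRootList.esymm_eq {d : ℕ} {b : ℕ → ℝ} {τ : Fin d → ℂ} (h : IsRootList b τ) (i : Fin d) :
    (Finset.univ.val.map τ).esymm (i + 1) = (-1) ^ (i + 1 : ℕ) * b (Fin.rev i) := by
  have h1 : monicPoly d b = ((Finset.univ.val.map τ).map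
      fun t => Polynomial.X - Polynomial.C t).prod := by
    refine Polynomial.funext fun t => ?_
    rw [eval_monicPoly, h t, Polynomial.eval_multiset_prod, Multiset.map_map, Multiset.map_map]
    simp only [Function.comp_def, Polynomial.eval_sub, Polynomial.eval_X, Polynomial.eval_C]
    rfl
  have h2 := Multiset.prod_X_sub_C_coeff (Finset.univ.val.map τ) (k := Fin.rev i) (by simp)
  rw [← h1, coeff_monicPoly b (Fin.rev i).2] at h2
  have h3 : Multiset.card (Finset.univ.val.map τ) - (Fin.rev i : ℕ) = i + 1 := by
    simp [Fin.val_rev]; omega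
  rw [h3] at h2
  rw [h2, ← mul_assoc, ← mul_pow]
  simp

theorem exists_subdiscriminant_eq_eval (d r : ℕ) : ∃ Q : MvPolynomial (Fin d) ℝ,
    ∀ (b : ℕ → ℝ) (τ : Fin d → ℂ), IsRootList b τ →
      ((MvPolynomial.eval (fun i : Fin d => b i) Q : ℝ) : ℂ) = subdiscriminant r τ := by
  obtain ⟨Q, hQ⟩ := exists_subdiscriminant_eq_aeval_esymm d r
  refine ⟨MvPolynomial.bind₁ (fun i : Fin d =>
    MvPolynomial.C ((-1 : ℝ) ^ (i + 1 : ℕ)) * MvPolynomial.X (Fin.rev i)) Q, fun b τ h => ?_⟩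
  rw [← hQ τ, ← MvPolynomial.coe_aeval_eq_eval]
  change Complex.ofRealAm (MvPolynomial.aeval _ _) = _
  rw [MvPolynomial.aeval_bind₁]
  simp only [h.esymm_eq]
  rw [MvPolynomial.comp_aeval_apply]
  congr 2
  ext i
  simp

theorem IsRootList.exists_conj {d : ℕ} {b : ℕ → ℝ} {τ : Fin d → ℂ} (h : IsRootList b τ)
    (i : Fin d) : ∃ j, τ j = (starRingEnd ℂ) (τ i) := by
  have h1 := h (τ i)
  rw [Finset.prod_eq_zero (Finset.mem_univ i) (sub_self _)] at h1
  have h2 := h ((starRingEnd ℂ) (τ i))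
  have h3 := congrArg (starRingEnd ℂ) h1
  simp only [map_add, map_pow, map_sum, map_mul, Complex.conj_ofReal, map_zero] at h3
  rw [h3, eq_comm, Finset.prod_eq_zero_iff] at h2
  obtain ⟨j, -, hj⟩ := h2
  exact ⟨j, (sub_eq_zero.1 hj).symm⟩

theorem IsRootList.norm_le {d : ℕ} {b : ℕ → ℝ} {τ : Fin d → ℂ} (h : IsRootList b τ)
    (i : Fin d) : ‖τ i‖ ≤ 1 + ∑ i ∈ Finset.range d, |b i| := by
  have h1 := h (τ i)
  rw [Finset.prod_eq_zero (Finset.mem_univ i) (sub_self _)] at h1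
  have h0 : 0 ≤ ∑ i ∈ Finset.range d, |b i| := Finset.sum_nonneg fun _ _ => abs_nonneg _
  by_contra! hlt
  have hone : 1 < ‖τ i‖ := by linarith
  obtain ⟨e, rfl⟩ : ∃ e, d = e + 1 := ⟨d - 1, by have := i.2; omega⟩
  have h2 : ‖τ i‖ ^ (e + 1) ≤ (∑ i ∈ Finset.range (e + 1), |b i|) * ‖τ i‖ ^ e := by
    rw [← norm_pow, eq_neg_of_add_eq_zero_left h1, norm_neg, Finset.sum_mul]
    refine norm_sum_le_of_le _ fun k hk => ?_
    rw [norm_mul, norm_pow, Complex.norm_real, Real.norm_eq_abs]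
    gcongr
    · exact hone.le
    · have := Finset.mem_range.1 hk; omega
  rw [pow_succ'] at h2
  have := le_of_mul_le_mul_right h2 (by positivity)
  linarith

theorem IsRootList.exists_norm_sub_pow_le {d : ℕ} (hd : 0 < d) {b : ℕ → ℝ} {τ : Fin d → ℂ}
    (h : IsRootList b τ) (t : ℝ) :
    ∃ i, ‖(t : ℂ) - τ i‖ ^ d ≤ |t ^ d + ∑ i ∈ Finset.range d, b i * t ^ i| := by
  have : Nonempty (Fin d) := ⟨⟨0, hd⟩⟩
  obtain ⟨i, -, hi⟩ := Finset.exists_min_image Finset.univ (fun i => ‖(t : ℂ) - τ i‖)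
    Finset.univ_nonempty
  refine ⟨i, ?_⟩
  have h1 : |t ^ d + ∑ i ∈ Finset.range d, b i * t ^ i| = ∏ j, ‖(t : ℂ) - τ j‖ := by
    rw [← norm_prod, ← h t, ← Real.norm_eq_abs, ← Complex.norm_real]
    push_cast
    rfl
  rw [h1]
  calc _ = ∏ _j : Fin d, ‖(t : ℂ) - τ i‖ := by simp
    _ ≤ _ := Finset.prod_le_prod (fun _ _ => norm_nonneg _) fun j hj => hi j hj

theorem prod_offDiag_eq_zero {d : ℕ} {τ : Fin d → ℂ} {S : Finset (Fin d)}
    (h : ¬ Set.InjOn τ S) : ∏ p ∈ S.offDiag, (τ p.1 - τ p.2) = 0 := by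
  simp only [Set.InjOn, not_forall] at h
  obtain ⟨i, hi, j, hj, hij, hne⟩ := h
  exact Finset.prod_eq_zero (i := (i, j)) (by simp_all [Finset.mem_offDiag]) (by simp [hij])

open scoped Classical in
theorem image_eq_of_injOn {d r : ℕ} {τ : Fin d → ℂ} {S : Finset (Fin d)} (hS : S.card = r)
    (h : Set.InjOn τ S) (hr : (Finset.univ.image τ).card ≤ r) :
    S.image τ = Finset.univ.image τ :=
  Finset.eq_of_subset_of_card_le (Finset.image_subset_image (Finset.subset_univ _)) (by
    rw [Finset.card_image_of_injOn h, hS]; exact hr)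

open scoped Classical in
theorem card_image_lt_of_subdiscriminant_eq_zero {d r : ℕ} {τ : Fin d → ℂ}
    (hr : (Finset.univ.image τ).card ≤ r) (h : subdiscriminant r τ = 0) :
    (Finset.univ.image τ).card < r := by
  refine lt_of_le_of_ne hr fun hr' => ?_
  set Δ : ℂ := ∏ p ∈ (Finset.univ.image τ).offDiag, (p.1 - p.2) with hΔ
  have hΔ0 : Δ ≠ 0 := by
    refine Finset.prod_ne_zero_iff.2 fun p hp => sub_ne_zero.2 ?_
    exact (Finset.mem_offDiag.1 hp).2.2
  have h1 : ∀ S ∈ Finset.powersetCard r (Finset.univ : Finset (Fin d)),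
      ∏ p ∈ S.offDiag, (τ p.1 - τ p.2) = if Set.InjOn τ S then Δ else 0 := by
    intro S hS
    split_ifs with hinj
    · rw [hΔ, ← image_eq_of_injOn (Finset.mem_powersetCard.1 hS).2 hinj hr]
      refine Finset.prod_bij (fun p _ => (τ p.1, τ p.2)) ?_ ?_ ?_ ?_
      · rintro ⟨a, b⟩ hab
        simp only [Finset.mem_offDiag] at hab ⊢
        exact ⟨Finset.mem_image_of_mem _ hab.1, Finset.mem_image_of_mem _ hab.2.1,
          fun hh => hab.2.2 (hinj hab.1 hab.2.1 hh)⟩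
      · rintro ⟨a, b⟩ hab ⟨a', b'⟩ hab' hh
        simp only [Finset.mem_offDiag] at hab hab'
        simp only [Prod.mk.injEq] at hh ⊢
        exact ⟨hinj hab.1 hab'.1 hh.1, hinj hab.2.1 hab'.2.1 hh.2⟩
      · rintro ⟨u, v⟩ huv
        simp only [Finset.mem_offDiag, Finset.mem_image] at huv
        obtain ⟨⟨a, ha, rfl⟩, ⟨b, hb, rfl⟩, hne⟩ := huv
        exact ⟨(a, b), Finset.mem_offDiag.2 ⟨ha, hb, fun hh => hne (congrArg τ hh)⟩, rfl⟩
      · intro p _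
        rfl
    · exact prod_offDiag_eq_zero hinj
  rw [subdiscriminant, Finset.sum_congr rfl h1, ← Finset.sum_filter, Finset.sum_const,
    smul_eq_zero] at h
  refine h.elim (fun h => ?_) hΔ0
  obtain ⟨S, -, hSinj, hSimg⟩ := Finset.exists_subset_injOn_image_eq_of_surjOn (f := τ)
    Set.univ (Finset.univ.image τ) (by intro v hv; simpa using hv)
  have hmem : S ∈ (Finset.powersetCard r Finset.univ).filter fun S : Finset (Fin d) =>
      Set.InjOn τ S := by
    rw [Finset.mem_filter, Finset.mem_powersetCard, ← hr', ← hSimg,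
      Finset.card_image_of_injOn hSinj]
    exact ⟨⟨Finset.subset_univ _, rfl⟩, hSinj⟩
  rw [Finset.card_eq_zero.1 h] at hmem
  simp at hmem

open scoped Classical in
theorem norm_subdiscriminant_le {d : ℕ} (r : ℕ) {R : ℝ} (hR : 0 ≤ R) {τ : Fin d → ℂ}
    (hr : (Finset.univ.image τ).card ≤ r) (hτ : ∀ i, ‖τ i‖ ≤ R) {i j : Fin d} (hij : τ i ≠ τ j) :
    ‖subdiscriminant r τ‖ ≤
      (Finset.powersetCard r (Finset.univ : Finset (Fin d))).card *
        ((1 + 2 * R) ^ (d * d) * ‖τ i - τ j‖) := by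
  rw [← nsmul_eq_mul, ← Finset.sum_const]
  refine norm_sum_le_of_le _ fun S hS => ?_
  by_cases hinj : Set.InjOn τ S
  · have himg := image_eq_of_injOn (Finset.mem_powersetCard.1 hS).2 hinj hr
    obtain ⟨i', hi', hi⟩ : ∃ i' ∈ S, τ i' = τ i := by
      rw [← Finset.mem_image, himg]; simp
    obtain ⟨j', hj', hj⟩ : ∃ j' ∈ S, τ j' = τ j := by
      rw [← Finset.mem_image, himg]; simp
    have hmem : (i', j') ∈ S.offDiag := Finset.mem_offDiag.2
      ⟨hi', hj', fun hh => hij (by simp only at hh; rw [← hi, ← hj, hh])⟩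
    rw [← Finset.prod_erase_mul _ _ hmem, norm_mul, norm_prod]
    simp only [hi, hj]
    gcongr
    calc _ ≤ ∏ _p ∈ S.offDiag.erase (i', j'), (1 + 2 * R) := by
          refine Finset.prod_le_prod (fun _ _ => norm_nonneg _) fun p _ => ?_
          refine (norm_sub_le _ _).trans ?_
          linarith [hτ p.1, hτ p.2]
      _ = (1 + 2 * R) ^ (S.offDiag.erase (i', j')).card := by rw [Finset.prod_const]
      _ ≤ _ := by
          refine pow_le_pow_right₀ (by linarith) ?_
          refine (Finset.card_le_univ _).trans_eq ?_
          simp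
  · rw [prod_offDiag_eq_zero hinj, norm_zero]
    positivity

theorem add_pow_le_two_pow {a b : ℝ} (ha : 0 ≤ a) (hb : 0 ≤ b) (n : ℕ) :
    (a + b) ^ n ≤ 2 ^ n * (a ^ n + b ^ n) :=
  (add_pow_le ha hb n).trans (by gcongr; exacts [by norm_num, Nat.sub_le _ _])

theorem IsRootList.exists_real_root_or {d : ℕ} (hd : 0 < d) (r : ℕ) {R : ℝ} (hR : 0 ≤ R) :
    ∃ C : ℝ, 0 ≤ C ∧ ∀ (b : ℕ → ℝ) (τ : Fin d → ℂ), IsRootList b τ → (∀ i, ‖τ i‖ ≤ R) →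
      (Set.range τ).ncard ≤ r → ∀ t : ℝ, ∃ q : ℝ, 0 ≤ q ∧
        q ^ d ≤ |t ^ d + ∑ i ∈ Finset.range d, b i * t ^ i| ∧
        ((∃ s : ℝ, |t - s| ≤ q ∧ s ^ d + ∑ i ∈ Finset.range d, b i * s ^ i = 0) ∨
          ‖subdiscriminant r τ‖ ≤ C * q) := by
  classical
  refine ⟨(Finset.powersetCard r (Finset.univ : Finset (Fin d))).card *
    ((1 + 2 * R) ^ (d * d) * 2), by positivity, fun b τ h hτ hr t => ?_⟩
  have hr' : (Finset.univ.image τ).card ≤ r := by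
    rw [← Set.ncard_coe_finset]; simpa using hr
  obtain ⟨i, hi⟩ := h.exists_norm_sub_pow_le hd t
  refine ⟨_, norm_nonneg _, hi, ?_⟩
  obtain ⟨j, hj⟩ := h.exists_conj i
  by_cases hij : τ i = τ j
  · left
    obtain ⟨s, hs⟩ := Complex.conj_eq_iff_real.1 (hj.symm.trans hij.symm)
    refine ⟨s, ?_, ?_⟩
    · rw [hs, ← Complex.ofReal_sub, Complex.norm_real, Real.norm_eq_abs]
    · have := h (τ i)
      rw [Finset.prod_eq_zero (Finset.mem_univ i) (sub_self _), hs] at this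
      exact_mod_cast this
  · right
    have h1 : ‖τ i - τ j‖ ≤ 2 * ‖(t : ℂ) - τ i‖ := by
      have h2 : ‖(t : ℂ) - τ j‖ = ‖(t : ℂ) - τ i‖ := by
        rw [hj, ← Complex.conj_ofReal t, ← map_sub, RCLike.norm_conj, Complex.conj_ofReal]
      calc ‖τ i - τ j‖ = ‖((t : ℂ) - τ j) - (t - τ i)‖ := by congr 1; ring
        _ ≤ _ := (norm_sub_le _ _).trans_eq (by rw [h2]; ring)
    refine (norm_subdiscriminant_le r hR hr' hτ hij).trans ?_
    rw [mul_assoc, mul_assoc]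
    gcongr

/-- The Łojasiewicz inequality at the origin, comparing the distance to `S` with `f`. -/
def LojasiewiczBound {G : Type*} [NormedAddCommGroup G] (S : Set G) (f : G → ℝ) : Prop :=
  ∃ (C : ℝ) (N : ℕ), 0 ≤ C ∧ 0 < N ∧ ∀ᶠ x in 𝓝 (0 : G), ∃ z ∈ S, ‖x - z‖ ^ N ≤ C * |f x|

theorem LojasiewiczBound.eventually_near {G : Type*} [NormedAddCommGroup G] {S : Set G}
    {f : G → ℝ} (h : LojasiewiczBound S f) (hf : ContinuousAt f 0) (h0 : f 0 = 0) :
    ∃ (C : ℝ) (N : ℕ), 0 ≤ C ∧ 0 < N ∧ ∀ p : G → Prop, (∀ᶠ x in 𝓝 (0 : G), p x) →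
      ∀ᶠ x in 𝓝 (0 : G), ∃ z ∈ S, p z ∧ ‖x - z‖ ≤ 1 ∧ ‖x - z‖ ^ N ≤ C * |f x| := by
  obtain ⟨C, N, hC, hN, h⟩ := h
  refine ⟨C, N, hC, hN, fun p hp => ?_⟩
  obtain ⟨ε, hε, hp⟩ := Metric.eventually_nhds_iff.1 hp
  set η := min 1 (ε / 2) with hη
  have hη0 : 0 < η := by positivity
  have h1 : ∀ᶠ x in 𝓝 (0 : G), C * |f x| < η ^ N := by
    have : ContinuousAt (fun x => C * |f x|) 0 := hf.abs.const_mul C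
    exact Tendsto.eventually_lt_const (by simp [h0, hη0]) this
  filter_upwards [h, h1, Metric.ball_mem_nhds (0 : G) (half_pos hε)] with x ⟨z, hz, hxz⟩ h1 h2
  have h3 : ‖x - z‖ < η := lt_of_pow_lt_pow_left₀ N hη0.le (hxz.trans_lt h1)
  refine ⟨z, hz, hp ?_, h3.le.trans (min_le_left _ _), hxz⟩
  rw [dist_zero_right]
  rw [mem_ball_zero_iff] at h2
  calc ‖z‖ = ‖x - (x - z)‖ := by congr 1; abel
    _ ≤ ‖x‖ + ‖x - z‖ := norm_sub_le _ _
    _ < ε / 2 + ε / 2 := add_lt_add h2 (h3.trans_le (min_le_right _ _))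
    _ = ε := add_halves ε

theorem AnalyticAt.exists_lipschitz_bound {G : Type*} [NormedAddCommGroup G] [NormedSpace ℝ G]
    {f : G → ℝ} (hf : AnalyticAt ℝ f 0) : ∃ (K : ℝ) (s : Set G), 0 ≤ K ∧ s ∈ 𝓝 (0 : G) ∧
      ∀ x ∈ s, ∀ y ∈ s, |f x - f y| ≤ K * ‖x - y‖ := by
  obtain ⟨K, s, hs, h⟩ := (hf.contDiffAt (n := 1)).exists_lipschitzOnWith
  refine ⟨K, s, K.2, hs, fun x hx y hy => ?_⟩
  simpa [Real.dist_eq, dist_eq_norm] using h.dist_le_mul x hx y hy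

/-- The monic polynomial of degree `d` in the second variable with lower coefficients `b`. -/
def fiberPoly {F : Type*} (d : ℕ) (b : ℕ → F → ℝ) (z : F × ℝ) : ℝ :=
  z.2 ^ d + ∑ i ∈ Finset.range d, b i z.1 * z.2 ^ i

theorem analyticAt_fiberPoly {F : Type*} [NormedAddCommGroup F] [NormedSpace ℝ F] {d : ℕ}
    {b : ℕ → F → ℝ} (hb : ∀ i, AnalyticAt ℝ (b i) 0) : AnalyticAt ℝ (fiberPoly d b) 0 := by
  refine (analyticAt_snd.pow d).add (Finset.analyticAt_fun_sum _ fun i _ => ?_)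
  exact (AnalyticAt.comp (f := Prod.fst) (g := b i) (x := (0 : F × ℝ)) (hb i)
    analyticAt_fst).mul (analyticAt_snd.pow i)

theorem pow_mul_le_of_pow_le {a Y h C : ℝ} {N M m : ℕ} (ha : 0 ≤ a) (hY : 0 ≤ Y) (hC : 0 ≤ C)
    (hh : 0 ≤ h) (hh1 : h ≤ 1) (hm : 0 < m) (haY : a ^ N ≤ C * Y) (hYh : Y ^ M ≤ 2 ^ M * 2 * h) :
    a ^ (m * (N * M)) ≤ C ^ (m * M) * (2 ^ M * 2) ^ m * h := by
  calc a ^ (m * (N * M)) = ((a ^ N) ^ M) ^ m := by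
        rw [← pow_mul, ← pow_mul]; congr 1; ring
    _ ≤ ((C * Y) ^ M) ^ m := by gcongr
    _ = C ^ (m * M) * (Y ^ M) ^ m := by
        rw [mul_pow, mul_pow, ← pow_mul, mul_comm M]
    _ ≤ C ^ (m * M) * (2 ^ M * 2 * h) ^ m := by gcongr
    _ = C ^ (m * M) * (2 ^ M * 2) ^ m * h ^ m := by rw [mul_pow (2 ^ M * 2), mul_assoc]
    _ ≤ C ^ (m * M) * (2 ^ M * 2) ^ m * h := by
        gcongr
        exact pow_le_of_le_one hh hh1 hm.ne'

/-- The inductive step in the proof of the Łojasiewicz inequality for `fiberPoly d b` over the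
zero set of `E`, when the polynomials have at most `r` roots there. -/
theorem lojasiewiczBound_fiberPoly_step {F : Type*} [NormedAddCommGroup F] [NormedSpace ℝ F]
    {d r : ℕ} (hd : 0 < d) {b : ℕ → F → ℝ} (hb : ∀ i, AnalyticAt ℝ (b i) 0) {D E : F → ℝ}
    (hD : AnalyticAt ℝ D 0) (hE : AnalyticAt ℝ E 0) (hE0 : E 0 = 0)
    (hP0 : fiberPoly d b 0 = 0) (hLoj : LojasiewiczBound (E ⁻¹' {0}) E)
    (hr : ∀ᶠ x in 𝓝 (0 : F), E x = 0 → ∀ τ : Fin d → ℂ, IsRootList (fun i => b i x) τ →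
      (Set.range τ).ncard ≤ r)
    (hdisc : ∀ x, ∀ τ : Fin d → ℂ, IsRootList (fun i => b i x) τ →
      (D x : ℂ) = subdiscriminant r τ)
    (hrec : D 0 = 0 → LojasiewiczBound {z : F × ℝ | fiberPoly d b z = 0 ∧ E z.1 = 0}
      fun z => |fiberPoly d b z| + (E z.1 ^ 2 + D z.1 ^ 2)) :
    LojasiewiczBound {z : F × ℝ | fiberPoly d b z = 0 ∧ E z.1 = 0}
      fun z => |fiberPoly d b z| + |E z.1| := by
  set H : F × ℝ → ℝ := fun z => |fiberPoly d b z| + |E z.1| with hHdef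
  have hPan := analyticAt_fiberPoly (d := d) hb
  have hH0 : ∀ z, 0 ≤ H z := fun z => by positivity
  have hHz : H 0 = 0 := by simp [hHdef, hP0, hE0]
  have hcomp : ∀ {g : F → ℝ}, ContinuousAt g 0 → ContinuousAt (fun z : F × ℝ => g z.1) 0 :=
    fun hg => ContinuousAt.comp (f := Prod.fst) hg continuousAt_fst
  have hHcont : ContinuousAt H 0 :=
    hPan.continuousAt.abs.add (hcomp hE.continuousAt).abs
  have hH1 : ∀ᶠ z in 𝓝 (0 : F × ℝ), H z < 1 :=
    Tendsto.eventually_lt_const (by simp [hHz]) hHcont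
  obtain ⟨K, s, hK, hs, hlip⟩ := hPan.exists_lipschitz_bound
  obtain ⟨K', s', hK', hs', hlip'⟩ := hD.exists_lipschitz_bound
  obtain ⟨u, hu, v, hv, huv⟩ := mem_nhds_prod_iff.1 hs
  set R : ℝ := 1 + ∑ i ∈ Finset.range d, (|b i 0| + 1) with hRdef
  have hR : 0 ≤ R := by positivity
  obtain ⟨C₀, hC₀, hroot⟩ := IsRootList.exists_real_root_or hd r hR
  obtain ⟨C, N, hC, hN, hE'⟩ := hLoj.eventually_near hE.continuousAt hE0
  have hbR : ∀ᶠ z in 𝓝 (0 : F), ∀ i ∈ Finset.range d, |b i z| ≤ |b i 0| + 1 := by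
    rw [Filter.eventually_all_finset]
    intro i _
    exact (Tendsto.eventually_lt_const (by linarith) (hb i).continuousAt.abs).mono
      fun _ h => h.le
  set C₂ : ℝ := 2 ^ N * (1 + K ^ N * C) with hC₂
  have hC₂0 : 0 ≤ C₂ := by positivity
  set C₃ : ℝ := 2 ^ (d * N) * (K' ^ (d * N) * C + C₀ ^ (d * N) * C₂) with hC₃
  have hC₃0 : 0 ≤ C₃ := by positivity
  have hDcont := hcomp hD.continuousAt
  have hDH : ∀ᶠ z in 𝓝 (0 : F × ℝ), C₃ * |D z.1| < 1 ∨ C₃ * H z < |D z.1| ^ (d * N) := by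
    by_cases hD0 : D 0 = 0
    · refine Eventually.mono (Tendsto.eventually_lt_const ?_ (hDcont.abs.const_mul C₃))
        fun z hz => Or.inl hz
      simp [hD0]
    · refine Eventually.mono (Tendsto.eventually_lt (hHcont.const_mul C₃)
        (hDcont.abs.pow (d * N)) ?_) fun z hz => Or.inr hz
      simpa [hHz] using pow_pos (abs_pos.2 hD0) (d * N)
  have hB : ∀ᶠ z in 𝓝 (0 : F × ℝ), H z < |D z.1| ^ (d * N + 1) →
      ∃ w ∈ {z : F × ℝ | fiberPoly d b z = 0 ∧ E z.1 = 0},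
        ‖z - w‖ ^ (d * N) ≤ (C + C₂) * H z := by
    have hp := hE' _ (hr.and (hbR.and (Filter.Eventually.and hu hs')))
    have hp' := (continuousAt_fst (p := (0 : F × ℝ))).eventually
      (hp.and (Filter.Eventually.and hu hs'))
    have hv' := (continuousAt_snd (p := (0 : F × ℝ))).eventually (Filter.eventually_mem_set.2 hv)
    filter_upwards [hp', hv', hH1, hDH] with ⟨x, t⟩ ⟨⟨z, hz, ⟨hzr, hzb, hzu, hzs⟩, hz1, hzN⟩, hxu, hxs⟩
      htv hH1 hDH hHD
    simp only at hz1 hzN hxu hxs htv hDH hHD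
    have hz : E z = 0 := hz
    set a := ‖x - z‖ with ha
    have ha0 : 0 ≤ a := norm_nonneg _
    set h := H (x, t) with hh
    have hh0 : 0 ≤ h := hH0 _
    have hPh : |fiberPoly d b (x, t)| ≤ h := le_add_of_nonneg_right (abs_nonneg _)
    have hEh : |E x| ≤ h := le_add_of_nonneg_left (abs_nonneg _)
    have haN : a ^ N ≤ C * h := hzN.trans (by gcongr)
    have haM : a ^ (d * N) ≤ C * h :=
      (pow_le_pow_of_le_one ha0 hz1 (Nat.le_mul_of_pos_left N hd)).trans haN
    obtain ⟨τ, hτ⟩ := exists_isRootList d (fun i => b i z)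
    have hτR : ∀ i, ‖τ i‖ ≤ R := fun i => (hτ.norm_le i).trans (by
      rw [hRdef]; gcongr with j hj; exact hzb j hj)
    obtain ⟨q, hq0, hqd, hq⟩ := hroot _ τ hτ hτR (hzr hz τ hτ) t
    have hPz : |fiberPoly d b (z, t)| ≤ h + K * a := by
      have h1 := hlip (z, t) (huv ⟨hzu, htv⟩) (x, t) (huv ⟨hxu, htv⟩)
      have h2 : ‖((z, t) : F × ℝ) - (x, t)‖ = a := by
        rw [Prod.mk_sub_mk, sub_self, ha, ← norm_neg (x - z), neg_sub]
        simp [Prod.norm_def]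
      rw [h2] at h1
      have h3 := abs_sub_abs_le_abs_sub (fiberPoly d b (z, t)) (fiberPoly d b (x, t))
      linarith
    have hqM : q ^ (d * N) ≤ C₂ * h := by
      calc q ^ (d * N) = (q ^ d) ^ N := pow_mul _ _ _
        _ ≤ (h + K * a) ^ N := by
            gcongr
            exact hqd.trans hPz
        _ ≤ 2 ^ N * (h ^ N + (K * a) ^ N) := add_pow_le_two_pow hh0 (by positivity) N
        _ ≤ 2 ^ N * (h + K ^ N * (C * h)) := by
            rw [mul_pow]
            gcongr
            exact pow_le_of_le_one hh0 hH1.le hN.ne'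
        _ = C₂ * h := by rw [hC₂]; ring
    rcases hq with ⟨y, hty, hy⟩ | hq
    · refine ⟨(z, y), ⟨hy, hz⟩, ?_⟩
      have h1 : ‖((x, t) : F × ℝ) - (z, y)‖ = max a |t - y| := by
        rw [Prod.mk_sub_mk, Prod.norm_def, Real.norm_eq_abs]
      rw [h1]
      rcases max_choice a |t - y| with h2 | h2 <;> rw [h2]
      · refine haM.trans ?_
        gcongr
        linarith
      · calc |t - y| ^ (d * N) ≤ q ^ (d * N) := by gcongr
          _ ≤ C₂ * h := hqM
          _ ≤ _ := by gcongr; linarith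
    · exfalso
      rw [← hdisc z τ hτ, Complex.norm_real, Real.norm_eq_abs] at hq
      have h1 : |D x| ≤ K' * a + C₀ * q := by
        have h2 := hlip' x hxs z hzs
        have h3 := abs_sub_abs_le_abs_sub (D x) (D z)
        linarith
      have h2 : |D x| ^ (d * N) ≤ C₃ * h := by
        calc |D x| ^ (d * N) ≤ (K' * a + C₀ * q) ^ (d * N) := by gcongr
          _ ≤ 2 ^ (d * N) * ((K' * a) ^ (d * N) + (C₀ * q) ^ (d * N)) :=
            add_pow_le_two_pow (by positivity) (by positivity) _
          _ ≤ 2 ^ (d * N) * (K' ^ (d * N) * (C * h) + C₀ ^ (d * N) * (C₂ * h)) := by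
            rw [mul_pow, mul_pow]; gcongr
          _ = C₃ * h := by rw [hC₃]; ring
      rcases hDH with h3 | h3
      · have h4 : 0 < |D x| ^ (d * N + 1) := hh0.trans_lt hHD
        have h5 : 0 < |D x| := by
          by_contra h5
          rw [le_antisymm (not_lt.1 h5) (abs_nonneg _), zero_pow (Nat.succ_ne_zero _)] at h4
          exact lt_irrefl _ h4
        have h6 : |D x| ^ (d * N) ≤ |D x| ^ (d * N) * (C₃ * |D x|) := by
          calc _ ≤ C₃ * |D x| ^ (d * N + 1) := h2.trans (by gcongr)
            _ = _ := by ring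
        have h7 : 0 < |D x| ^ (d * N) := by positivity
        nlinarith
      · linarith
  have habs : ∀ z, |H z| = H z := fun z => abs_of_nonneg (hH0 z)
  by_cases hD0 : D 0 = 0
  · obtain ⟨C₁, N₁, hC₁, hN₁, hA⟩ := hrec hD0
    have hM : 0 < d * N := by positivity
    refine ⟨C₁ ^ (d * N * (d * N + 1)) * (2 ^ (d * N + 1) * 2) ^ (d * N) + (C + C₂) ^ (N₁ * (d * N + 1)), d * N * (N₁ * (d * N + 1)), by positivity,
      by positivity, ?_⟩
    have hD1 : ∀ᶠ z in 𝓝 (0 : F × ℝ), |D z.1| < 1 :=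
      Tendsto.eventually_lt_const (by simp [hD0]) hDcont.abs
    filter_upwards [hB, hA, hH1, hD1] with z hB hA hH1 hD1
    rw [habs]
    have hz0 := hH0 z
    rcases lt_or_ge (H z) (|D z.1| ^ (d * N + 1)) with hlt | hge
    · obtain ⟨w, hw, hzw⟩ := hB hlt
      refine ⟨w, hw, ?_⟩
      rw [pow_mul]
      calc (‖z - w‖ ^ (d * N)) ^ (N₁ * (d * N + 1)) ≤ ((C + C₂) * H z) ^ (N₁ * (d * N + 1)) := by
            gcongr
        _ ≤ (C + C₂) ^ (N₁ * (d * N + 1)) * H z := by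
            rw [mul_pow]
            gcongr
            exact pow_le_of_le_one hz0 hH1.le (by positivity)
        _ ≤ _ := by
            gcongr
            exact le_add_of_nonneg_left (by positivity)
    · obtain ⟨w, ⟨hw1, hw2⟩, hzw⟩ := hA
      refine ⟨w, ⟨hw1, hw2⟩, ?_⟩
      set M := d * N + 1 with hMdef
      set Y := |fiberPoly d b z| + (E z.1 ^ 2 + D z.1 ^ 2) with hY
      have hY0 : 0 ≤ Y := by positivity
      rw [abs_of_nonneg hY0] at hzw
      have h1 : Y ≤ H z + |D z.1| := by
        have h2 : |E z.1| < 1 := lt_of_le_of_lt (le_add_of_nonneg_left (abs_nonneg _)) hH1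
        have h3 : E z.1 ^ 2 ≤ |E z.1| := by
          rw [← sq_abs]; exact pow_le_of_le_one (abs_nonneg _) h2.le two_ne_zero
        have h4 : D z.1 ^ 2 ≤ |D z.1| := by
          rw [← sq_abs]; exact pow_le_of_le_one (abs_nonneg _) hD1.le two_ne_zero
        simp only [hY, hHdef]
        linarith
      have h2 : Y ^ M ≤ 2 ^ M * 2 * H z := by
        calc Y ^ M ≤ (H z + |D z.1|) ^ M := by gcongr
          _ ≤ 2 ^ M * (H z ^ M + |D z.1| ^ M) := add_pow_le_two_pow hz0 (abs_nonneg _) _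
          _ ≤ 2 ^ M * (H z + H z) := by
              gcongr
              exact pow_le_of_le_one hz0 hH1.le (Nat.succ_ne_zero _)
          _ = _ := by ring
      refine (pow_mul_le_of_pow_le (norm_nonneg _) hY0 hC₁ hz0 hH1.le hM hzw h2).trans ?_
      exact mul_le_mul_of_nonneg_right (le_add_of_nonneg_right (by positivity)) hz0
  · have : ∀ᶠ z in 𝓝 (0 : F × ℝ), H z < |D z.1| ^ (d * N + 1) := by
      refine Tendsto.eventually_lt hHcont (hDcont.abs.pow (d * N + 1)) ?_
      simpa [hHz] using pow_pos (abs_pos.2 hD0) (d * N + 1)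
    refine ⟨C + C₂, d * N, by positivity, by positivity, ?_⟩
    filter_upwards [hB, this] with z h1 h2
    rw [habs]
    exact h1 h2

theorem lojasiewiczBound_fiberPoly {F : Type*} [NormedAddCommGroup F] [NormedSpace ℝ F]
    {d : ℕ} {b : ℕ → F → ℝ} (hb : ∀ i, AnalyticAt ℝ (b i) 0) (hP0 : fiberPoly d b 0 = 0)
    (hLoj : ∀ E : F → ℝ, AnalyticAt ℝ E 0 → E 0 = 0 → LojasiewiczBound (E ⁻¹' {0}) E) (r : ℕ)
    {E : F → ℝ} (hE : AnalyticAt ℝ E 0) (hE0 : E 0 = 0)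
    (hr : ∀ᶠ x in 𝓝 (0 : F), E x = 0 → ∀ τ : Fin d → ℂ, IsRootList (fun i => b i x) τ →
      (Set.range τ).ncard ≤ r) :
    LojasiewiczBound {z : F × ℝ | fiberPoly d b z = 0 ∧ E z.1 = 0}
      fun z => |fiberPoly d b z| + |E z.1| := by
  classical
  have hd : 0 < d := by
    rcases Nat.eq_zero_or_pos d with rfl | hd
    · simp [fiberPoly] at hP0
    · exact hd
  induction r generalizing E with
  | zero =>
    obtain ⟨τ, hτ⟩ := exists_isRootList d (fun i => b i 0)
    have h1 := hr.self_of_nhds hE0 τ hτ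
    rw [Nat.le_zero, Set.ncard_eq_zero (Set.finite_range τ)] at h1
    exact absurd (Set.mem_range_self (f := τ) ⟨0, hd⟩) (by simp [h1])
  | succ r ih =>
    obtain ⟨Q, hQ⟩ := exists_subdiscriminant_eq_eval d (r + 1)
    have hDan : AnalyticAt ℝ (fun x => MvPolynomial.eval (fun i : Fin d => b i x) Q) 0 :=
      AnalyticAt.aeval_mvPolynomial (fun i : Fin d => hb i) Q
    refine lojasiewiczBound_fiberPoly_step hd hb hDan hE hE0 hP0 (hLoj E hE hE0) hr
      (fun x τ hτ => hQ _ τ hτ) fun hD0 => ?_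
    set D : F → ℝ := fun x => MvPolynomial.eval (fun i : Fin d => b i x) Q with hD
    have hED : ∀ x, E x ^ 2 + D x ^ 2 = 0 → E x = 0 ∧ D x = 0 := fun x hx => by
      constructor <;> nlinarith [sq_nonneg (E x), sq_nonneg (D x)]
    have := ih (E := fun x => E x ^ 2 + D x ^ 2) ((hE.pow 2).add (hDan.pow 2))
      (by simp only [hE0, show D 0 = 0 from hD0]; norm_num) ?_
    · obtain ⟨C, N, hC, hN, h⟩ := this
      refine ⟨C, N, hC, hN, h.mono fun z ⟨w, ⟨hw1, hw2⟩, hw3⟩ => ⟨w, ⟨hw1, (hED _ hw2).1⟩, ?_⟩⟩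
      beta_reduce at hw3
      rwa [abs_of_nonneg (by positivity : 0 ≤ E z.1 ^ 2 + D z.1 ^ 2)] at hw3
    · filter_upwards [hr] with x hx hx0 τ hτ
      obtain ⟨hEx, hDx⟩ := hED x hx0
      have h1 := hx hEx τ hτ
      have h2 := hQ _ τ hτ
      rw [show MvPolynomial.eval (fun i : Fin d => b i x) Q = 0 from hDx] at h2
      have h3 : (Set.range τ).ncard = (Finset.univ.image τ).card := by
        rw [← Set.ncard_coe_finset]; simp
      rw [h3] at h1 ⊢
      exact Nat.lt_succ_iff.1 (card_image_lt_of_subdiscriminant_eq_zero h1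
        (by simpa using h2.symm))

theorem AnalyticAt.lojasiewiczBound_prod {F : Type*} [NormedAddCommGroup F] [NormedSpace ℝ F]
    (hLoj : ∀ E : F → ℝ, AnalyticAt ℝ E 0 → E 0 = 0 → LojasiewiczBound (E ⁻¹' {0}) E)
    {f : F × ℝ → ℝ} (hf : AnalyticAt ℝ f 0) (hf0 : f 0 = 0)
    (h0 : ¬ ∀ᶠ t in 𝓝 (0 : ℝ), f (0, t) = 0) : LojasiewiczBound (f ⁻¹' {0}) f := by
  obtain ⟨d, b, C, hb, h⟩ := hf.exists_weierstrass_polynomial h0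
  have hP0 : fiberPoly d b 0 = 0 := by
    have h1 := h.self_of_nhds.1
    rw [hf0, abs_zero, mul_zero] at h1
    exact abs_nonpos_iff.1 h1
  have h1 := lojasiewiczBound_fiberPoly hb hP0 hLoj d (E := fun _ => 0) analyticAt_const rfl
    (Eventually.of_forall fun x _ τ _ => by
      rw [← Set.image_univ]
      refine (Set.ncard_image_le Set.finite_univ).trans ?_
      simp [Set.ncard_univ])
  obtain ⟨C', N, hC', hN, h2⟩ := h1.eventually_near
    (by simpa using (analyticAt_fiberPoly (d := d) hb).continuousAt.abs) (by simp [hP0])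
  refine ⟨C' * max C 0, N, by positivity, hN, ?_⟩
  filter_upwards [h, h2 _ h] with z hz ⟨w, ⟨hw, _⟩, ⟨_, hw0⟩, _, hzw⟩
  refine ⟨w, hw0 hw, hzw.trans ?_⟩
  simp only [abs_zero, add_zero, abs_abs]
  rw [mul_assoc]
  gcongr
  refine hz.1.trans ?_
  gcongr
  exact le_max_left _ _

/-- **Łojasiewicz's inequality**: near a zero, a real analytic function is bounded below by a
power of the distance to its zero set. -/
theorem AnalyticAt.lojasiewiczBound {G : Type*} [NormedAddCommGroup G] [NormedSpace ℝ G]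
    [FiniteDimensional ℝ G] {f : G → ℝ} (hf : AnalyticAt ℝ f 0) (hf0 : f 0 = 0) :
    LojasiewiczBound (f ⁻¹' {0}) f := by
  induction hn : Module.finrank ℝ G using Nat.strong_induction_on generalizing G with
  | _ n ih =>
    subst hn
    by_cases hev : ∀ᶠ x in 𝓝 (0 : G), f x = 0
    · exact ⟨1, 1, zero_le_one, one_pos, hev.mono fun x hx => ⟨x, hx, by simp⟩⟩
    obtain ⟨ε, hε, hball⟩ := hf.exists_ball_analyticOnNhd
    obtain ⟨x, hxε, hx⟩ : ∃ x ∈ Metric.ball (0 : G) ε, f x ≠ 0 := by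
      by_contra! hall
      exact hev (Filter.mem_of_superset (Metric.ball_mem_nhds 0 hε) hall)
    have hline : ¬ ∀ᶠ t in 𝓝 (0 : ℝ), f (t • x) = 0 := by
      intro h
      have h1 : AnalyticOnNhd ℝ (fun t : ℝ => f (t • x)) (Icc 0 1) := by
        intro t ht
        refine AnalyticAt.comp (g := f) (f := fun t : ℝ => t • x) (hball _ ?_) 
          (analyticAt_id.smul analyticAt_const)
        rw [mem_ball_zero_iff] at hxε ⊢
        rw [norm_smul, Real.norm_of_nonneg ht.1]
        exact (mul_le_of_le_one_left (norm_nonneg _) ht.2).trans_lt hxε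
      have h2 := h1.eqOn_zero_of_preconnected_of_eventuallyEq_zero isPreconnected_Icc
        (left_mem_Icc.2 zero_le_one) h (right_mem_Icc.2 zero_le_one)
      simp only [one_smul, Pi.zero_apply] at h2
      exact hx h2
    have hx0 : x ≠ 0 := by rintro rfl; exact hx hf0
    obtain ⟨φ, hφ⟩ := SeparatingDual.exists_eq_one (R := ℝ) hx0
    let e : G ≃L[ℝ] ℝ × φ.ker := ContinuousLinearEquiv.equivOfRightInverse φ
      (ContinuousLinearMap.toSpanSingleton ℝ x) (fun t => by simp [hφ])
    let Φ : G ≃L[ℝ] φ.ker × ℝ := e.trans (ContinuousLinearEquiv.prodComm ℝ ℝ φ.ker)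
    have hΦ : ∀ t : ℝ, Φ.symm (0, t) = t • x := fun t => by
      simp [Φ, e, ContinuousLinearEquiv.equivOfRightInverse_symm_apply]
    have hlt : Module.finrank ℝ φ.ker < Module.finrank ℝ G := by
      refine Submodule.finrank_lt fun h => ?_
      have : x ∈ φ.ker := h ▸ Submodule.mem_top
      rw [LinearMap.mem_ker] at this
      simp [hφ] at this
    have hg : AnalyticAt ℝ (fun z => f (Φ.symm z)) 0 := by
      refine AnalyticAt.comp (g := f) (f := Φ.symm) ?_ (Φ.symm.analyticAt 0)
      rwa [map_zero]
    obtain ⟨C, N, hC, hN, h⟩ := AnalyticAt.lojasiewiczBound_prod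
      (fun E hE hE0 => ih _ hlt hE hE0 rfl) hg (by simpa using hf0) (by simpa [hΦ] using hline)
    refine ⟨‖(Φ.symm : φ.ker × ℝ →L[ℝ] G)‖ ^ N * C, N, by positivity, hN, ?_⟩
    have hcont : Tendsto Φ (𝓝 0) (𝓝 0) := by
      simpa using Φ.continuous.tendsto 0
    filter_upwards [hcont.eventually h] with y ⟨w, hw, hyw⟩
    refine ⟨Φ.symm w, hw, ?_⟩
    have h1 : y - Φ.symm w = (Φ.symm : φ.ker × ℝ →L[ℝ] G) (Φ y - w) := by simp
    rw [h1, mul_assoc]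
    simp only [ContinuousLinearEquiv.symm_apply_apply] at hyw
    calc _ ≤ (‖(Φ.symm : φ.ker × ℝ →L[ℝ] G)‖ * ‖Φ y - w‖) ^ N := by
          gcongr; exact ContinuousLinearMap.le_opNorm _ _
      _ = ‖(Φ.symm : φ.ker × ℝ →L[ℝ] G)‖ ^ N * ‖Φ y - w‖ ^ N := mul_pow _ _ _
      _ ≤ _ := by gcongr

/-- Łojasiewicz's inequality at an arbitrary zero, with control on the nearby zero. -/
theorem AnalyticAt.exists_norm_sub_pow_le {G : Type*} [NormedAddCommGroup G] [NormedSpace ℝ G]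
    [FiniteDimensional ℝ G] {f : G → ℝ} {a : G} (hf : AnalyticAt ℝ f a) (hfa : f a = 0) :
    ∃ (C : ℝ) (N : ℕ), 0 ≤ C ∧ 0 < N ∧ ∀ p : G → Prop, (∀ᶠ x in 𝓝 a, p x) →
      ∀ᶠ x in 𝓝 a, ∃ z, f z = 0 ∧ p z ∧ ‖x - z‖ ≤ 1 ∧ ‖x - z‖ ^ N ≤ C * |f x| := by
  have hg : AnalyticAt ℝ (fun x => f (a + x)) 0 :=
    AnalyticAt.comp (g := f) (f := fun x => a + x) (by simpa using hf)
      (analyticAt_const.add analyticAt_id)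
  obtain ⟨C, N, hC, hN, h⟩ := (hg.lojasiewiczBound (by simpa using hfa)).eventually_near
    hg.continuousAt (by simpa using hfa)
  refine ⟨C, N, hC, hN, fun p hp => ?_⟩
  have hadd : Tendsto (fun x => a + x) (𝓝 0) (𝓝 a) := by
    simpa using (continuous_const.add continuous_id).tendsto (0 : G) (f := fun x => a + x)
  have hsub : Tendsto (fun x => x - a) (𝓝 a) (𝓝 0) := by
    simpa using (continuous_id.sub continuous_const).tendsto a (f := fun x => x - a)
  filter_upwards [hsub.eventually (h _ (hadd.eventually hp))] with x ⟨z, hz, hpz, h1, hN⟩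
  rw [show x - a - z = x - (a + z) by abel] at h1 hN
  rw [show a + (x - a) = x by abel] at hN
  exact ⟨a + z, hz, hpz, h1, hN⟩

section Flat

open scoped Classical in
/-- The function `φ ∘ s` extended by zero to `A`. -/
def descend {E F G : Type*} [Zero G] (A : Set F) (s : F → E) (φ : E → G) (x : F) : G := if x ∈ A then 0 else φ (s x)

theorem descend_of_mem {E F G : Type*} [Zero G] {A : Set F} {s : F → E} {φ : E → G} {x : F} (hx : x ∈ A) :
    descend A s φ x = 0 := if_pos hx

theorem descend_of_notMem {E F G : Type*} [Zero G] {A : Set F} {s : F → E} {φ : E → G} {x : F} (hx : x ∉ A) :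
    descend A s φ x = φ (s x) := if_neg hx

universe u

variable {E F G H : Type*} [NormedAddCommGroup E] [NormedSpace ℝ E] [NormedAddCommGroup F]
  [NormedSpace ℝ F] [NormedAddCommGroup G] [NormedSpace ℝ G] [NormedAddCommGroup H]
  [NormedSpace ℝ H]

/-- A function `h` is flat on `B` if it is smooth on `V` and all of its iterated derivatives vanish
at the points of `B`. -/
def FlatOn (B V : Set E) (h : E → G) : Prop :=
  ContDiffOn ℝ (⊤ : ℕ∞) h V ∧ ∀ k : ℕ, ∀ x ∈ B, iteratedFDerivWithin ℝ k h V x = 0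

namespace FlatOn

variable {B V : Set E} {h : E → G}

theorem eq_zero (hh : FlatOn B V h) {x : E} (hx : x ∈ B) : h x = 0 := by
  rw [← norm_eq_zero, ← norm_iteratedFDerivWithin_zero (𝕜 := ℝ) (s := V), hh.2 0 x hx, norm_zero]

theorem congr {h' : E → G} (hh : FlatOn B V h) (hBV : B ⊆ V) (he : EqOn h' h V) :
    FlatOn B V h' :=
  ⟨hh.1.congr he, fun k x hx => by rw [iteratedFDerivWithin_congr he (hBV hx), hh.2 k x hx]⟩

theorem flatOn_fderiv (hh : FlatOn B V h) (hV : IsOpen V) (hBV : B ⊆ V) : FlatOn B V (fderiv ℝ h) := by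
  have h1 : FlatOn B V (fderivWithin ℝ h V) := by
    refine ⟨hh.1.fderivWithin hV.uniqueDiffOn (by simp), fun k x hx => ?_⟩
    rw [← norm_eq_zero, norm_iteratedFDerivWithin_fderivWithin hV.uniqueDiffOn (hBV hx),
      hh.2 _ x hx, norm_zero]
  exact h1.congr hBV fun x hx => (fderivWithin_of_isOpen hV hx).symm

theorem bilinear (hh : FlatOn B V h) (hV : IsOpen V) (hBV : B ⊆ V) (L : G →L[ℝ] F →L[ℝ] H)
    {c : E → F} (hc : ContDiffOn ℝ (⊤ : ℕ∞) c V) : FlatOn B V fun y => L (h y) (c y) := by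
  refine ⟨L.isBoundedBilinearMap.contDiff.comp_contDiffOn (hh.1.prodMk hc), fun k x hx => ?_⟩
  have h1 := L.norm_iteratedFDerivWithin_le_of_bilinear hh.1 hc hV.uniqueDiffOn (hBV hx)
    (n := k) (by exact_mod_cast le_top)
  rw [← norm_le_zero_iff]
  refine h1.trans (le_of_eq ?_)
  rw [Finset.sum_eq_zero, mul_zero]
  intro i _
  rw [hh.2 i x hx, norm_zero, mul_zero, zero_mul]

theorem sub {h' : E → G} (hh : FlatOn B V h) (hh' : FlatOn B V h') (hV : IsOpen V) (hBV : B ⊆ V) :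
    FlatOn B V fun y => h y - h' y := by
  refine ⟨hh.1.sub hh'.1, fun k x hx => ?_⟩
  rw [fun_iteratedFDerivWithin_sub_apply ((hh.1 x (hBV hx)).of_le (by exact_mod_cast le_top))
    ((hh'.1 x (hBV hx)).of_le (by exact_mod_cast le_top)) hV.uniqueDiffOn (hBV hx),
    hh.2 k x hx, hh'.2 k x hx, sub_zero]

theorem comp {A U : Set F} {f : F → G} {g : E → F} (hf : FlatOn A U f) (hU : IsOpen U)
    (hV : IsOpen V) (hg : ContDiffOn ℝ (⊤ : ℕ∞) g V) (hgVU : MapsTo g V U) (hBV : B ⊆ V)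
    (hgBA : MapsTo g B A) : FlatOn B V (f ∘ g) := by
  refine ⟨hf.1.comp hg hgVU, fun k x hx => ?_⟩
  set c := fun i => ‖iteratedFDerivWithin ℝ i g V x‖
  have h1 := norm_iteratedFDerivWithin_comp_le (n := k) hf.1 hg (by exact_mod_cast le_top)
    hU.uniqueDiffOn hV.uniqueDiffOn hgVU (hBV hx) (C := 0)
    (D := 1 + ∑ i ∈ Finset.range (k + 1), c i)
    (fun i _ => by rw [hf.2 i _ (hgBA hx), norm_zero]) fun i hi hik => ?_
  · simpa using h1
  · have h2 : c i ≤ ∑ i ∈ Finset.range (k + 1), c i :=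
      Finset.single_le_sum (f := c) (fun _ _ => norm_nonneg _) (Finset.mem_range_succ_iff.2 hik)
    have h3 : 0 ≤ c i := norm_nonneg _
    exact (by linarith : c i ≤ 1 + ∑ i ∈ Finset.range (k + 1), c i).trans
      (le_self_pow₀ (by linarith) (by omega))

/-- Taylor's formula for flat functions. -/
theorem exists_norm_le_pow {E G : Type u} [NormedAddCommGroup E] [NormedSpace ℝ E]
    [NormedAddCommGroup G] [NormedSpace ℝ G] {B V : Set E} {h : E → G}
    (hh : FlatOn B V h) (hV : IsOpen V) (hBV : B ⊆ V) {b₀ : E}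
    (hb₀ : b₀ ∈ B) (M : ℕ) : ∃ C r : ℝ, 0 ≤ C ∧ 0 < r ∧ ∀ b ∈ B ∩ Metric.ball b₀ r,
      ∀ y ∈ Metric.ball b₀ r, ‖h y‖ ≤ C * ‖y - b‖ ^ M := by
  induction M generalizing G with
  | zero =>
    have h1 : ContinuousAt h b₀ := hh.1.continuousOn.continuousAt (hV.mem_nhds (hBV hb₀))
    have h2 : ∀ᶠ y in 𝓝 b₀, ‖h y‖ < 1 :=
      Tendsto.eventually_lt_const (by simp [hh.eq_zero hb₀]) h1.norm
    obtain ⟨r, hr, h3⟩ := Metric.eventually_nhds_iff_ball.1 h2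
    exact ⟨1, r, zero_le_one, hr, fun b _ y hy => by simpa using (h3 y hy).le⟩
  | succ M ih =>
    obtain ⟨C, r, hC, hr, h1⟩ := ih (hh.flatOn_fderiv hV hBV)
    obtain ⟨r', hr', h2⟩ := Metric.isOpen_iff.1 hV b₀ (hBV hb₀)
    refine ⟨C, min r r', hC, lt_min hr hr', fun b hb y hy => ?_⟩
    have hseg : segment ℝ b y ⊆ Metric.ball b₀ (min r r') :=
      (convex_ball _ _).segment_subset hb.2 hy
    have hsr := hseg.trans (Metric.ball_subset_ball (min_le_left _ _))
    have hsV := (hseg.trans (Metric.ball_subset_ball (min_le_right _ _))).trans h2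
    have h3 := (convex_segment b y).norm_image_sub_le_of_norm_fderiv_le (𝕜 := ℝ) (f := h)
      (C := C * ‖y - b‖ ^ M)
      (fun z hz => (hh.1.contDiffAt (hV.mem_nhds (hsV hz))).differentiableAt (by simp))
      (fun z hz => (h1 b ⟨hb.1, Metric.ball_subset_ball (min_le_left _ _) hb.2⟩ z
        (hsr hz)).trans ?_) (left_mem_segment ℝ b y) (right_mem_segment ℝ b y)
    · rwa [hh.eq_zero hb.1, sub_zero, mul_assoc, ← pow_succ] at h3
    · gcongr
      rw [segment_symm] at hz
      simpa [dist_eq_norm, norm_sub_rev] using (segment_subset_closedBall_right y b hz)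

/-- A flat function divided by a power of an analytic function is still infinitesimal. -/
theorem tendsto_inv_pow_smul {E G : Type u} [NormedAddCommGroup E] [NormedSpace ℝ E]
    [NormedAddCommGroup G] [NormedSpace ℝ G] [FiniteDimensional ℝ E]
    {B V : Set E} {h : E → G} (hh : FlatOn B V h) (hV : IsOpen V)
    (hBV : B ⊆ V) {δ : E → ℝ} (hδ : AnalyticOnNhd ℝ δ V) (hδB : ∀ y ∈ V, δ y = 0 → y ∈ B) (m : ℕ)
    {b : E} (hb : b ∈ B) : Tendsto (fun y => (δ y ^ m)⁻¹ • h y) (𝓝 b) (𝓝 0) := by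
  have hVb := hV.mem_nhds (hBV hb)
  have hcont : ContinuousAt δ b := (hδ b (hBV hb)).continuousAt
  by_cases hδb : δ b = 0
  · obtain ⟨C, N, hC, hN, h1⟩ := (hδ b (hBV hb)).exists_norm_sub_pow_le hδb
    obtain ⟨C', r, hC', hr, h2⟩ := hh.exists_norm_le_pow hV hBV hb (N * (m + 1))
    have h3 := h1 (fun z => z ∈ V ∧ z ∈ Metric.ball b r)
      (Filter.Eventually.and hVb (Metric.ball_mem_nhds b hr))
    have h4 : Tendsto (fun y => C' * C ^ (m + 1) * |δ y|) (𝓝 b) (𝓝 0) := by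
      have := (hcont.abs.const_mul (C' * C ^ (m + 1))).tendsto
      simpa [hδb] using this
    refine squeeze_zero_norm' ?_ h4
    filter_upwards [h3, Metric.ball_mem_nhds b hr] with y ⟨z, hz, ⟨hzV, hzr⟩, _, hyz⟩ hy
    have h5 := h2 z ⟨hδB z hzV hz, hzr⟩ y hy
    have h6 : ‖h y‖ ≤ C' * C ^ (m + 1) * |δ y| * |δ y| ^ m := by
      calc ‖h y‖ ≤ C' * (‖y - z‖ ^ N) ^ (m + 1) := by rwa [← pow_mul]
        _ ≤ C' * (C * |δ y|) ^ (m + 1) := by gcongr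
        _ = _ := by ring
    rw [norm_smul, norm_inv, norm_pow, Real.norm_eq_abs]
    have h7 : 0 ≤ C' * C ^ (m + 1) * |δ y| := by positivity
    rcases eq_or_lt_of_le (by positivity : 0 ≤ |δ y| ^ m) with h8 | h8
    · rw [← h8, inv_zero, zero_mul]; exact h7
    · rw [inv_mul_le_iff₀ h8]; linarith
  · have h1 : ContinuousAt (fun y => (δ y ^ m)⁻¹ • h y) b :=
      ((hcont.pow m).inv₀ (pow_ne_zero m hδb)).smul (hh.1.continuousOn.continuousAt hVb)
    have h2 := h1.tendsto
    rwa [hh.eq_zero hb, smul_zero] at h2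

end FlatOn

/-- A continuous function that vanishes on a relatively closed set `A`, and whose derivative outside
`A` tends to zero near `a ∈ A`, has zero derivative at `a`. -/
theorem hasFDerivAt_zero_of_tendsto {U A : Set E} (hU : IsOpen U) (hA : closure A ∩ U = A)
    {F : E → G} {F' : E → E →L[ℝ] G} (hF : ∀ x ∈ U \ A, HasFDerivAt F (F' x) x)
    (hFc : ContinuousOn F U) (hFA : ∀ x ∈ A, F x = 0) {a : E} (ha : a ∈ A)
    (hF' : Tendsto F' (𝓝[U \ A] a) (𝓝 0)) : HasFDerivAt F (0 : E →L[ℝ] G) a := by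
  have haU : a ∈ U := (hA.symm ▸ ha : a ∈ closure A ∩ U).2
  rw [hasFDerivAt_iff_isLittleO, Asymptotics.isLittleO_iff]
  intro ε hε
  have h1 : ∀ᶠ x in 𝓝[U \ A] a, ‖F' x‖ < ε :=
    Tendsto.eventually_lt_const (by simpa using hε) hF'.norm
  rw [eventually_nhdsWithin_iff] at h1
  obtain ⟨r, hr, h2⟩ := Metric.eventually_nhds_iff_ball.1 (h1.and (hU.mem_nhds haU))
  filter_upwards [Metric.ball_mem_nhds a hr] with x hx
  rw [hFA a ha, sub_zero, zero_apply, sub_zero]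
  set γ : ℝ → E := fun t => x + t • (a - x) with hγ
  have hγc : Continuous γ := by fun_prop
  have hγball : ∀ t ∈ Icc (0 : ℝ) 1, γ t ∈ Metric.ball a r := fun t ht =>
    (convex_ball a r).add_smul_sub_mem hx (Metric.mem_ball_self hr) ht
  set T : Set ℝ := Icc 0 1 ∩ γ ⁻¹' (closure A) with hT
  have hTA : ∀ t ∈ Icc (0 : ℝ) 1, γ t ∈ A ↔ t ∈ T := fun t ht => by
    refine ⟨fun h => ⟨ht, subset_closure h⟩, fun h => ?_⟩
    rw [← hA]
    exact ⟨h.2, (h2 _ (hγball t ht)).2⟩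
  have hTc : IsCompact T := isCompact_Icc.inter_right (isClosed_closure.preimage hγc)
  have hT1 : (1 : ℝ) ∈ T := (hTA 1 (by simp)).1 (by simpa [hγ] using ha)
  obtain ⟨t, htT, hmin⟩ := hTc.exists_isLeast ⟨1, hT1⟩
  have ht01 := htT.1
  have hsub : Icc 0 t ⊆ Icc (0 : ℝ) 1 := Icc_subset_Icc_right ht01.2
  have hnA : ∀ u ∈ Ico 0 t, γ u ∈ U \ A := fun u hu => by
    have hu1 := hsub (Ico_subset_Icc_self hu)
    exact ⟨(h2 _ (hγball u hu1)).2, fun h => not_le.2 hu.2 (hmin ((hTA u hu1).1 h))⟩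
  have h3 := norm_image_sub_le_of_norm_deriv_right_le_segment (f := F ∘ γ) (a := 0) (b := t)
    (f' := fun u => F' (γ u) (a - x)) (C := ε * ‖x - a‖)
    (hFc.comp hγc.continuousOn fun u hu => (h2 _ (hγball u (hsub hu))).2)
    (fun u hu => ?_) (fun u hu => ?_) t ⟨ht01.1, le_rfl⟩
  · rw [Function.comp_apply, Function.comp_apply, hFA _ ((hTA t ht01).2 htT), zero_sub, norm_neg,
      sub_zero] at h3
    have h4 : γ 0 = x := by simp [hγ]
    rw [h4] at h3
    exact h3.trans (mul_le_of_le_one_right (by positivity) ht01.2)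
  · have h4 : HasDerivAt γ (a - x) u := by
      simpa only [id, one_smul] using ((hasDerivAt_id u).smul_const (a - x)).const_add x
    exact ((hF _ (hnA u hu)).comp_hasDerivAt u h4).hasDerivWithinAt
  · rw [norm_sub_rev x a]
    refine (ContinuousLinearMap.le_opNorm _ _).trans ?_
    gcongr
    exact ((h2 _ (hγball u (hsub (Ico_subset_Icc_self hu)))).1 (hnA u hu)).le

theorem tendsto_descend [ProperSpace F] {U A : Set F} {V : Set E} {π : E → F} {s : F → E}
    (hU : IsOpen U) (hAU : A ⊆ U) (hπ : ContinuousOn π V)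
    (hproper : ∀ K ⊆ U, IsCompact K → IsCompact (V ∩ π ⁻¹' K)) (hs : MapsTo s (U \ A) V)
    (hπs : ∀ x ∈ U \ A, π (s x) = x) {φ : E → G}
    (hφ : ∀ b ∈ V ∩ π ⁻¹' A, Tendsto φ (𝓝 b) (𝓝 0)) {a : F} (ha : a ∈ A) :
    Tendsto (descend A s φ) (𝓝 a) (𝓝 0) := by
  rw [Metric.tendsto_nhds]
  intro ε hε
  set W : Set E := interior {y : E | dist (φ y) 0 < ε}
  have hBW : V ∩ π ⁻¹' A ⊆ W := fun b hb =>
    mem_interior_iff_mem_nhds.2 (Metric.tendsto_nhds.1 (hφ b hb) ε hε)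
  obtain ⟨r, hr, hball⟩ := Metric.nhds_basis_closedBall.mem_iff.1 (hU.mem_nhds (hAU ha))
  set K := Metric.closedBall a r
  have hL : IsCompact ((V ∩ π ⁻¹' K) \ W) :=
    (hproper K hball (isCompact_closedBall a r)).diff isOpen_interior
  have hπL : IsCompact (π '' ((V ∩ π ⁻¹' K) \ W)) :=
    hL.image_of_continuousOn (hπ.mono fun y hy => hy.1.1)
  have haL : a ∉ π '' ((V ∩ π ⁻¹' K) \ W) := by
    rintro ⟨y, ⟨⟨hyV, _⟩, hyW⟩, rfl⟩
    exact hyW (hBW ⟨hyV, ha⟩)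
  filter_upwards [hπL.isClosed.isOpen_compl.mem_nhds haL, Metric.closedBall_mem_nhds a hr]
    with x hxL hxK
  by_cases hxA : x ∈ A
  · rwa [descend_of_mem hxA, dist_self]
  · rw [descend_of_notMem hxA]
    have hxUA : x ∈ U \ A := ⟨hball hxK, hxA⟩
    by_contra hx
    refine hxL ⟨s x, ⟨⟨hs hxUA, ?_⟩, fun h => hx (show s x ∈ {y : E | dist (φ y) 0 < ε} from interior_subset h)⟩, hπs x hxUA⟩
    rw [mem_preimage, hπs x hxUA]
    exact hxK

end Flat

section Descend
universe u

variable {E F : Type u} [NormedAddCommGroup E] [NormedSpace ℝ E]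
  [NormedAddCommGroup F] [NormedSpace ℝ F]

/-- The numerator of the derivative of `(δ ^ m)⁻¹ • h` composed with a local inverse. -/
def quotientNumerator {G : Type u} [NormedAddCommGroup G] [NormedSpace ℝ G] (δ : E → ℝ)
    (adj : E → F →L[ℝ] E) (m : ℕ) (h : E → G) (y : E) : F →L[ℝ] G :=
  (δ y • fderiv ℝ h y - (m : ℝ) • (fderiv ℝ δ y).smulRight (h y)) ∘L adj y

theorem FlatOn.flatOn_quotientNumerator {G : Type u} [NormedAddCommGroup G] [NormedSpace ℝ G]
    {B V : Set E} (hV : IsOpen V) (hBV : B ⊆ V) {δ : E → ℝ} (hδ : ContDiffOn ℝ (⊤ : ℕ∞) δ V)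
    {adj : E → F →L[ℝ] E} (hadj : ContDiffOn ℝ (⊤ : ℕ∞) adj V) (m : ℕ) {h : E → G}
    (hh : FlatOn B V h) : FlatOn B V (quotientNumerator δ adj m h) := by
  have hδ₁ : ContDiffOn ℝ (⊤ : ℕ∞) (fderiv ℝ δ) V := hδ.fderiv_of_isOpen hV (by simp)
  have hδ' : ContDiffOn ℝ (⊤ : ℕ∞) (fun y => (m : ℝ) • fderiv ℝ δ y) V :=
    hδ₁.const_smul (m : ℝ)
  have h1 := (hh.flatOn_fderiv hV hBV).bilinear hV hBV
    (ContinuousLinearMap.lsmul ℝ ℝ : ℝ →L[ℝ] (E →L[ℝ] G) →L[ℝ] E →L[ℝ] G).flip hδ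
  have h2 := hh.bilinear hV hBV (ContinuousLinearMap.smulRightL ℝ E G).flip hδ'
  refine ((h1.sub h2 hV hBV).bilinear hV hBV (ContinuousLinearMap.compL ℝ F E G) hadj).congr hBV
    fun y _ => ?_
  ext v
  simp [quotientNumerator]

theorem hasFDerivAt_descend {G : Type u} [NormedAddCommGroup G] [NormedSpace ℝ G]
    {A : Set F} {s : F → E} {δ : E → ℝ} {adj : E → F →L[ℝ] E} {x : F} (hA : ∀ᶠ z in 𝓝 x, z ∉ A)
    (hδx : δ (s x) ≠ 0) (hs : HasFDerivAt s ((δ (s x))⁻¹ • adj (s x)) x)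
    (hδ : DifferentiableAt ℝ δ (s x)) (m : ℕ) {h : E → G} (hh : DifferentiableAt ℝ h (s x)) :
    HasFDerivAt (descend A s fun y => (δ y ^ m)⁻¹ • h y)
      (descend A s (fun y => (δ y ^ (m + 2))⁻¹ • quotientNumerator δ adj m h y) x) x := by
  rw [descend_of_notMem hA.self_of_nhds]
  refine HasFDerivAt.congr_of_eventuallyEq ?_ (hA.mono fun z hz => descend_of_notMem hz)
  have h1 : HasFDerivAt (fun y => δ y ^ m) ((m * δ (s x) ^ (m - 1)) • fderiv ℝ δ (s x)) (s x) := by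
    simpa using hδ.hasFDerivAt.pow m
  have h2 := HasDerivAt.comp_hasFDerivAt (f := fun y => δ y ^ m) (s x)
    (hasDerivAt_inv (pow_ne_zero m hδx)) h1
  have h3 := (h2.smul hh.hasFDerivAt).comp x hs
  refine h3.congr_fderiv ?_
  ext v
  have h4 : (m * δ (s x) ^ (m - 1) : ℝ) * δ (s x) = m * δ (s x) ^ m := by
    rcases m with _ | m
    · simp
    · simp [pow_succ, mul_assoc]
  simp only [quotientNumerator, Function.comp_apply, ContinuousLinearMap.comp_apply,
    _root_.add_apply, _root_.sub_apply, _root_.smul_apply, ContinuousLinearMap.smulRight_apply,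
    map_smul]
  set a := δ (s x)
  set w := fderiv ℝ h (s x) (adj (s x) v)
  set c := fderiv ℝ δ (s x) (adj (s x) v)
  rw [(eq_div_iff hδx).2 h4]
  clear_value a
  match_scalars
  · field_simp
    ring
  · simp only [smul_eq_mul]
    field_simp
    ring

/-- The maps and sets for which flat functions descend: `s` inverts the proper map `π` over the
complement of `A`, with derivative `δ⁻¹ • adj`. -/
structure DescentData (U A : Set F) (V B : Set E) (π : E → F) (s : F → E) (δ : E → ℝ)
    (adj : E → F →L[ℝ] E) : Prop where
  isOpen_target : IsOpen U
  isOpen_source : IsOpen V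
  subset_target : A ⊆ U
  closure_inter : closure A ∩ U = A
  eq_preimage : B = V ∩ π ⁻¹' A
  continuousOn : ContinuousOn π V
  isCompact_preimage : ∀ K ⊆ U, IsCompact K → IsCompact (V ∩ π ⁻¹' K)
  mapsTo : MapsTo s (U \ A) V
  right_inv : ∀ x ∈ U \ A, π (s x) = x
  analyticOnNhd : AnalyticOnNhd ℝ δ V
  contDiffOn : ContDiffOn ℝ (⊤ : ℕ∞) adj V
  mem_of_eq_zero : ∀ y ∈ V, δ y = 0 → y ∈ B
  hasFDerivAt : ∀ x ∈ U \ A, HasFDerivAt s ((δ (s x))⁻¹ • adj (s x)) x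

namespace DescentData

variable {U A : Set F} {V B : Set E} {π : E → F} {s : F → E} {δ : E → ℝ} {adj : E → F →L[ℝ] E}

theorem flatOn_quotientNumerator (H : DescentData U A V B π s δ adj) {G : Type u}
    [NormedAddCommGroup G] [NormedSpace ℝ G] (m : ℕ) {h : E → G} (hh : FlatOn B V h) :
    FlatOn B V (quotientNumerator δ adj m h) :=
  hh.flatOn_quotientNumerator H.isOpen_source (H.eq_preimage ▸ inter_subset_left)
    (H.analyticOnNhd.contDiffOn H.isOpen_source.uniqueDiffOn) H.contDiffOn m

variable [FiniteDimensional ℝ E] [FiniteDimensional ℝ F]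

theorem hasFDerivAt_and_tendsto (H : DescentData U A V B π s δ adj) {G : Type u}
    [NormedAddCommGroup G] [NormedSpace ℝ G] (m : ℕ) {h : E → G} (hh : FlatOn B V h) :
    (∀ x ∈ U \ A, HasFDerivAt (descend A s fun y => (δ y ^ m)⁻¹ • h y)
      (descend A s (fun y => (δ y ^ (m + 2))⁻¹ • quotientNumerator δ adj m h y) x) x) ∧
    ∀ a ∈ A, Tendsto (descend A s fun y => (δ y ^ m)⁻¹ • h y) (𝓝 a) (𝓝 0) := by
  have hBV : B ⊆ V := H.eq_preimage ▸ inter_subset_left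
  have : ProperSpace F := FiniteDimensional.proper ℝ F
  refine ⟨fun x hx => ?_, fun a ha => ?_⟩
  · have hsx := H.mapsTo hx
    have hsV := H.isOpen_source.mem_nhds hsx
    have hxA : ∀ᶠ z in 𝓝 x, z ∉ A := by
      have : x ∉ closure A := fun h => hx.2 (H.closure_inter ▸ ⟨h, hx.1⟩)
      filter_upwards [isClosed_closure.isOpen_compl.mem_nhds this] with z hz h
      exact hz (subset_closure h)
    refine hasFDerivAt_descend hxA (fun h => hx.2 ?_) (H.hasFDerivAt x hx)
      (H.analyticOnNhd _ hsx).differentiableAt m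
      ((hh.1.contDiffAt hsV).differentiableAt (by simp))
    have h1 := H.mem_of_eq_zero _ hsx h
    rw [H.eq_preimage] at h1
    rw [← H.right_inv x hx]
    exact h1.2
  · exact tendsto_descend H.isOpen_target H.subset_target H.continuousOn
      H.isCompact_preimage H.mapsTo H.right_inv (fun b hb => hh.tendsto_inv_pow_smul
        H.isOpen_source hBV H.analyticOnNhd H.mem_of_eq_zero m (H.eq_preimage ▸ hb)) ha

theorem continuousOn_descend (H : DescentData U A V B π s δ adj) {G : Type u}
    [NormedAddCommGroup G] [NormedSpace ℝ G] (m : ℕ) {h : E → G} (hh : FlatOn B V h) :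
    ContinuousOn (descend A s fun y => (δ y ^ m)⁻¹ • h y) U := by
  obtain ⟨h1, h2⟩ := H.hasFDerivAt_and_tendsto m hh
  intro x hx
  by_cases hxA : x ∈ A
  · have := h2 x hxA
    rw [← descend_of_mem (s := s) (φ := fun y => (δ y ^ m)⁻¹ • h y) hxA] at this
    exact ContinuousAt.continuousWithinAt this
  · exact (h1 x ⟨hx, hxA⟩).continuousAt.continuousWithinAt

theorem hasFDerivAt_descend (H : DescentData U A V B π s δ adj) {G : Type u}
    [NormedAddCommGroup G] [NormedSpace ℝ G] (m : ℕ) {h : E → G} (hh : FlatOn B V h) {x : F}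
    (hx : x ∈ U) : HasFDerivAt (descend A s fun y => (δ y ^ m)⁻¹ • h y)
      (descend A s (fun y => (δ y ^ (m + 2))⁻¹ • quotientNumerator δ adj m h y) x) x := by
  have h1 := (H.hasFDerivAt_and_tendsto m hh).1
  by_cases hxA : x ∈ A
  · rw [descend_of_mem hxA]
    exact hasFDerivAt_zero_of_tendsto H.isOpen_target H.closure_inter h1
      (H.continuousOn_descend m hh) (fun _ ha => descend_of_mem ha) hxA
      (((H.hasFDerivAt_and_tendsto (m + 2) (H.flatOn_quotientNumerator m hh)).2 x
        hxA).mono_left nhdsWithin_le_nhds)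
  · exact h1 x ⟨hx, hxA⟩

theorem contDiffOn_descend (H : DescentData U A V B π s δ adj) (k : ℕ) {G : Type u}
    [NormedAddCommGroup G] [NormedSpace ℝ G] (m : ℕ) {h : E → G} (hh : FlatOn B V h) :
    ContDiffOn ℝ k (descend A s fun y => (δ y ^ m)⁻¹ • h y) U := by
  induction k generalizing G m with
  | zero => exact contDiffOn_zero.2 (H.continuousOn_descend m hh)
  | succ k ih =>
    have h1 := fun x hx => H.hasFDerivAt_descend m hh (x := x) hx
    rw [Nat.cast_succ, contDiffOn_succ_iff_fderiv_of_isOpen H.isOpen_target]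
    refine ⟨fun x hx => (h1 x hx).differentiableAt.differentiableWithinAt, by simp, ?_⟩
    exact (ih (m + 2) (H.flatOn_quotientNumerator m hh)).congr fun x hx => (h1 x hx).fderiv

theorem iteratedFDerivWithin_descend (H : DescentData U A V B π s δ adj) (k : ℕ) {G : Type u}
    [NormedAddCommGroup G] [NormedSpace ℝ G] (m : ℕ) {h : E → G} (hh : FlatOn B V h) {a : F}
    (ha : a ∈ A) :
    iteratedFDerivWithin ℝ k (descend A s fun y => (δ y ^ m)⁻¹ • h y) U a = 0 := by
  rw [← norm_eq_zero]
  have hU := H.isOpen_target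
  have haU := H.subset_target ha
  induction k generalizing G m with
  | zero => rw [norm_iteratedFDerivWithin_zero, descend_of_mem ha, norm_zero]
  | succ k ih =>
    rw [← norm_iteratedFDerivWithin_fderivWithin hU.uniqueDiffOn haU,
      ← ih (m + 2) (H.flatOn_quotientNumerator m hh)]
    congr 1
    refine iteratedFDerivWithin_congr (fun x hx => ?_) haU k
    rw [fderivWithin_of_isOpen hU hx]
    exact (H.hasFDerivAt_descend m hh hx).fderiv

theorem flatOn_descend (H : DescentData U A V B π s δ adj) {G : Type u}
    [NormedAddCommGroup G] [NormedSpace ℝ G] {h : E → G} (hh : FlatOn B V h) :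
    FlatOn A U (descend A s h) := by
  have h1 : (descend A s fun y => (δ y ^ 0)⁻¹ • h y) = descend A s h := by simp
  rw [← h1]
  exact ⟨contDiffOn_infty.2 fun k => H.contDiffOn_descend k 0 hh,
    fun k a ha => H.iteratedFDerivWithin_descend k 0 hh ha⟩

end DescentData

end Descend

section Adjugate

variable {n : ℕ}

/-- The adjugate of an endomorphism of `ℝⁿ`. -/
def clmAdjugate (L : EuclideanSpace ℝ (Fin n) →L[ℝ] EuclideanSpace ℝ (Fin n)) :
    EuclideanSpace ℝ (Fin n) →L[ℝ] EuclideanSpace ℝ (Fin n) :=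
  LinearMap.toContinuousLinearMap (Matrix.toLin (EuclideanSpace.basisFun (Fin n) ℝ).toBasis
    (EuclideanSpace.basisFun (Fin n) ℝ).toBasis
    (LinearMap.toMatrix (EuclideanSpace.basisFun (Fin n) ℝ).toBasis
      (EuclideanSpace.basisFun (Fin n) ℝ).toBasis (L : _ →ₗ[ℝ] _)).adjugate)

theorem clmAdjugate_comp (L : EuclideanSpace ℝ (Fin n) →L[ℝ] EuclideanSpace ℝ (Fin n)) :
    clmAdjugate L ∘L L = L.det • ContinuousLinearMap.id ℝ _ := by
  set e := (EuclideanSpace.basisFun (Fin n) ℝ).toBasis with he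
  have h1 : Matrix.toLin e e (LinearMap.toMatrix e e (L : _ →ₗ[ℝ] _)).adjugate ∘ₗ
      (L : EuclideanSpace ℝ (Fin n) →ₗ[ℝ] _) = L.det • LinearMap.id := by
    conv_lhs => rw [← Matrix.toLin_toMatrix e e (L : EuclideanSpace ℝ (Fin n) →ₗ[ℝ] _)]
    rw [LinearMap.toMatrix_toLin, ← Matrix.toLin_mul, Matrix.adjugate_mul, map_smul,
      Matrix.toLin_one, LinearMap.det_toMatrix]
  ext1 v
  exact LinearMap.congr_fun h1 v

theorem contDiff_clm_toMatrix {N : WithTop ℕ∞} (i j : Fin n) :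
    ContDiff ℝ N fun L : EuclideanSpace ℝ (Fin n) →L[ℝ] EuclideanSpace ℝ (Fin n) =>
      LinearMap.toMatrix (EuclideanSpace.basisFun (Fin n) ℝ).toBasis
        (EuclideanSpace.basisFun (Fin n) ℝ).toBasis (L : _ →ₗ[ℝ] _) i j := by
  simp only [LinearMap.toMatrix_apply, OrthonormalBasis.coe_toBasis_repr_apply,
    EuclideanSpace.basisFun_repr, ContinuousLinearMap.coe_coe]
  fun_prop

theorem Matrix.contDiff_det {E ι : Type*} [NormedAddCommGroup E] [NormedSpace ℝ E] [Fintype ι]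
    [DecidableEq ι] {N : WithTop ℕ∞} {M : E → Matrix ι ι ℝ}
    (hM : ∀ i j, ContDiff ℝ N fun x => M x i j) : ContDiff ℝ N fun x => (M x).det := by
  simp only [Matrix.det_apply']
  exact ContDiff.sum fun σ _ => contDiff_const.mul (contDiff_prod fun i _ => hM _ _)

theorem contDiff_clm_det {N : WithTop ℕ∞} : ContDiff ℝ N
    fun L : EuclideanSpace ℝ (Fin n) →L[ℝ] EuclideanSpace ℝ (Fin n) => L.det := by
  have h := Matrix.contDiff_det (contDiff_clm_toMatrix (n := n) (N := N))
  simpa only [LinearMap.det_toMatrix] using h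

theorem Matrix.contDiff_linearMap {E F ι : Type*} [NormedAddCommGroup E] [NormedSpace ℝ E]
    [NormedAddCommGroup F] [NormedSpace ℝ F] [Fintype ι] [DecidableEq ι] {N : WithTop ℕ∞}
    (T : Matrix ι ι ℝ →ₗ[ℝ] F) {M : E → Matrix ι ι ℝ} (hM : ∀ i j, ContDiff ℝ N fun x => M x i j) :
    ContDiff ℝ N fun x => T (M x) := by
  have hT : ∀ M, T M = ∑ i, ∑ j, M i j • T (Matrix.single i j 1) := fun M => by
    conv_lhs => rw [Matrix.matrix_eq_sum_single M]
    simp only [map_sum, ← map_smul, Matrix.smul_single, smul_eq_mul, mul_one]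
  simp only [fun x => hT (M x)]
  exact ContDiff.sum fun i _ => ContDiff.sum fun j _ => (hM i j).smul contDiff_const

theorem contDiff_clmAdjugate {N : WithTop ℕ∞} : ContDiff ℝ N (clmAdjugate (n := n)) := by
  refine Matrix.contDiff_linearMap ((LinearMap.toContinuousLinearMap (𝕜 := ℝ)
    (E := EuclideanSpace ℝ (Fin n)) (F' := EuclideanSpace ℝ (Fin n))).toLinearMap ∘ₗ
    (Matrix.toLin (EuclideanSpace.basisFun (Fin n) ℝ).toBasis
      (EuclideanSpace.basisFun (Fin n) ℝ).toBasis).toLinearMap) fun i j => ?_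
  simp only [Matrix.adjugate_apply]
  refine Matrix.contDiff_det fun k l => ?_
  simp only [Matrix.updateRow_apply]
  split_ifs
  · exact contDiff_const
  · exact contDiff_clm_toMatrix k l

end Adjugate

end

/-- If `π : V → U` is a proper surjective real-analytic map restricting to a bijection
`V \ B → U \ A` (where `B = π⁻¹ A`) with real-analytic inverse `s`, then `f ↦ f ∘ π` restricts to
an `ℝ`-algebra isomorphism from `𝒥^∞(A, U)` onto `𝒥^∞(B, V)`: it maps `𝒥^∞(A, U)` into
`𝒥^∞(B, V)`, it is injective (two flat functions with equal pullbacks agree on `U`), and it is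
surjective (every `g ∈ 𝒥^∞(B, V)` is of the form `f ∘ π` on `V`). -/
theorem pullback_iso_flat_ideals {n : ℕ} (U V : Set (EuclideanSpace ℝ (Fin n)))
    (hU : IsOpen U) (hV : IsOpen V)
    (π : EuclideanSpace ℝ (Fin n) → EuclideanSpace ℝ (Fin n))
    (hπan : AnalyticOnNhd ℝ π V) (hπmaps : Set.MapsTo π V U) (hπsurj : π '' V = U)
    (hπproper : ∀ K ⊆ U, IsCompact K → IsCompact (V ∩ π ⁻¹' K))
    (A : Set (EuclideanSpace ℝ (Fin n))) (hAne : A.Nonempty) (hAU : A ⊆ U)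
    (hArc : closure A ∩ U = A) (hAsa : SemiAnalytic A)
    (B : Set (EuclideanSpace ℝ (Fin n))) (hB : B = V ∩ π ⁻¹' A)
    (hbij : Set.BijOn π (V \ B) (U \ A))
    (s : EuclideanSpace ℝ (Fin n) → EuclideanSpace ℝ (Fin n))
    (hs : AnalyticOnNhd ℝ s (U \ A)) (hsmaps : Set.MapsTo s (U \ A) (V \ B))
    (hsinv : ∀ x ∈ U \ A, π (s x) = x) (hsinv' : ∀ y ∈ V \ B, s (π y) = y) :
    (∀ f, JInf A U f → JInf B V (f ∘ π)) ∧
    (∀ f g, JInf A U f → JInf A U g → Set.EqOn (f ∘ π) (g ∘ π) V → Set.EqOn f g U) ∧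
    (∀ g, JInf B V g → ∃ f, JInf A U f ∧ Set.EqOn (f ∘ π) g V) := by
  change (∀ f : _ → ℝ, FlatOn A U f → FlatOn B V (f ∘ π)) ∧
    (∀ f g : _ → ℝ, FlatOn A U f → FlatOn A U g → Set.EqOn (f ∘ π) (g ∘ π) V → Set.EqOn f g U) ∧
    (∀ g : _ → ℝ, FlatOn B V g → ∃ f : _ → ℝ, FlatOn A U f ∧ Set.EqOn (f ∘ π) g V)
  have hBV : B ⊆ V := hB ▸ Set.inter_subset_left
  refine ⟨fun f hf => FlatOn.comp hf hU hV (hπan.contDiffOn hV.uniqueDiffOn) hπmaps hBV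
    fun y hy => (hB ▸ hy : y ∈ V ∩ π ⁻¹' A).2, fun f g _ _ hfg x hx => ?_, fun g hg => ?_⟩
  · obtain ⟨y, hy, rfl⟩ := hπsurj.symm ▸ hx
    exact hfg hy
  have hπ' : AnalyticOnNhd ℝ (fderiv ℝ π) V := hπan.fderiv
  have hUA : IsOpen (U \ A) := by
    have h1 : U \ A = U \ closure A := by
      ext x
      refine and_congr_right fun hx => not_congr ⟨fun h => subset_closure h, fun h => ?_⟩
      rw [← hArc]
      exact ⟨h, hx⟩
    rw [h1]
    exact hU.sdiff isClosed_closure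
  have hcomp : ∀ x ∈ U \ A, fderiv ℝ π (s x) ∘L fderiv ℝ s x = ContinuousLinearMap.id ℝ _ := by
    intro x hx
    have h1 := (hπan (s x) (hsmaps hx).1).differentiableAt.hasFDerivAt.comp x
      (hs x hx).differentiableAt.hasFDerivAt
    have h2 : HasFDerivAt (π ∘ s) (ContinuousLinearMap.id ℝ _) x :=
      (hasFDerivAt_id x).congr_of_eventuallyEq
        (Filter.eventuallyEq_of_mem (hUA.mem_nhds hx) hsinv)
    exact h1.unique h2
  have hdet : ∀ x ∈ U \ A, (fderiv ℝ π (s x)).det ≠ 0 := by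
    intro x hx h
    have h1 := congrArg (fun L => LinearMap.det (ContinuousLinearMap.toLinearMap L)) (hcomp x hx)
    have h2 : LinearMap.det ((fderiv ℝ π (s x)).toLinearMap ∘ₗ (fderiv ℝ s x).toLinearMap) =
      LinearMap.det (LinearMap.id : EuclideanSpace ℝ (Fin n) →ₗ[ℝ] _) := h1
    rw [LinearMap.det_comp, LinearMap.det_id] at h2
    rw [ContinuousLinearMap.det] at h
    rw [h, zero_mul] at h2
    exact zero_ne_one h2
  have H : DescentData U A V B π s (fun y => (fderiv ℝ π y).det)
      (fun y => clmAdjugate (fderiv ℝ π y)) :=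
    { isOpen_target := hU
      isOpen_source := hV
      subset_target := hAU
      closure_inter := hArc
      eq_preimage := hB
      continuousOn := hπan.continuousOn
      isCompact_preimage := hπproper
      mapsTo := fun x hx => (hsmaps hx).1
      right_inv := hsinv
      analyticOnNhd := fun y hy =>
        ((contDiff_omega_iff_analyticOnNhd.1 contDiff_clm_det) _ trivial).comp (hπ' y hy)
      contDiffOn := contDiff_clmAdjugate.comp_contDiffOn (hπ'.contDiffOn hV.uniqueDiffOn)
      mem_of_eq_zero := fun y hy h => by
        by_contra hyB
        refine hdet (π y) (hbij.mapsTo ⟨hy, hyB⟩) ?_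
        rwa [hsinv' y ⟨hy, hyB⟩]
      hasFDerivAt := fun x hx => by
        refine (hs x hx).differentiableAt.hasFDerivAt.congr_fderiv ?_
        rw [eq_inv_smul_iff₀ (hdet x hx)]
        calc (fderiv ℝ π (s x)).det • fderiv ℝ s x
            = (clmAdjugate (fderiv ℝ π (s x)) ∘L fderiv ℝ π (s x)) ∘L fderiv ℝ s x := by
              rw [clmAdjugate_comp]
              rfl
          _ = clmAdjugate (fderiv ℝ π (s x)) ∘L (fderiv ℝ π (s x) ∘L fderiv ℝ s x) := rfl
          _ = _ := by rw [hcomp x hx, ContinuousLinearMap.comp_id] }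
  refine ⟨descend A s g, H.flatOn_descend hg, fun y hy => ?_⟩
  by_cases hyB : y ∈ B
  · rw [hg.eq_zero hyB, Function.comp_apply, descend_of_mem]
    rw [hB] at hyB
    exact hyB.2
  · have h1 := hbij.mapsTo ⟨hy, hyB⟩
    rw [Function.comp_apply, descend_of_notMem h1.2, hsinv' y ⟨hy, hyB⟩]
end
end

section
/- Let V ⊆ ℝⁿ be open and convex with 0 ∈ V, and let X ⊆ V be relatively closed in V, star-shaped with respect to 0 (i.e., (1−t)·x ∈ X for every x ∈ X and t ∈ [0,1]), and with 0 ∈ X. If f ∈ C^∞(V,ℝ) is such that ∂f/∂x_i ∈ 𝒥^∞(X,V) for every i = 1,…,n, then f − f(0) ∈ 𝒥^∞(X,V). (Degree-zero Whitney–de Rham Poincaré lemma via the radial homotopy H(x,t) = (1−t)x.) -/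
noncomputable section

/-- A continuous linear functional on Euclidean space is zero if it kills the standard basis. -/
lemma clm_eq_zero_of_apply_single_eq_zero {n : ℕ} (L : EuclideanSpace ℝ (Fin n) →L[ℝ] ℝ)
    (h : ∀ i, L (EuclideanSpace.single i 1) = 0) : L = 0 := by
  apply ContinuousLinearMap.coe_injective
  refine (EuclideanSpace.basisFun (Fin n) ℝ).toBasis.ext fun i => ?_
  simpa using h i

/-- If all iterated derivatives of order `k` of the first partial derivatives vanish at `x`, so
does the iterated derivative of order `k` of the differential. -/
lemma iteratedFDerivWithin_eq_zero_of_apply_single {n : ℕ} {V : Set (EuclideanSpace ℝ (Fin n))}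
    (hV : IsOpen V) {F : EuclideanSpace ℝ (Fin n) → EuclideanSpace ℝ (Fin n) →L[ℝ] ℝ}
    (hF : ContDiffOn ℝ (⊤ : ℕ∞) F V) {x : EuclideanSpace ℝ (Fin n)} (hx : x ∈ V) (k : ℕ)
    (h : ∀ i, iteratedFDerivWithin ℝ k (fun y => F y (EuclideanSpace.single i 1)) V x = 0) :
    iteratedFDerivWithin ℝ k F V x = 0 := by
  ext1 m
  refine clm_eq_zero_of_apply_single_eq_zero _ fun i => ?_
  have key := (ContinuousLinearMap.apply ℝ ℝ
    (EuclideanSpace.single i (1 : ℝ) : EuclideanSpace ℝ (Fin n))).iteratedFDerivWithin_comp_left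
      (hF x hx) hV.uniqueDiffOn hx (i := k) (by exact_mod_cast le_top)
  have hz : iteratedFDerivWithin ℝ k ((ContinuousLinearMap.apply ℝ ℝ
    (EuclideanSpace.single i (1 : ℝ) : EuclideanSpace ℝ (Fin n))) ∘ F) V x = 0 := h i
  rw [hz] at key
  exact (congrArg (fun M => M m) key).symm

/-- Degree-zero Whitney–de Rham Poincaré lemma via the radial homotopy: if `V` is open convex
with `0 ∈ V`, `X ⊆ V` is relatively closed, star-shaped with respect to `0` and `0 ∈ X`, and
`f ∈ C^∞(V)` has all first-order partial derivatives in `𝒥^∞(X, V)`, then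
`f - f 0 ∈ 𝒥^∞(X, V)`. -/
theorem radial_degree_zero_poincare {n : ℕ} (V X : Set (EuclideanSpace ℝ (Fin n)))
    (hV : IsOpen V) (hconv : Convex ℝ V) (h0V : (0 : EuclideanSpace ℝ (Fin n)) ∈ V)
    (hXV : X ⊆ V) (hrc : closure X ∩ V = X)
    (hstar : ∀ x ∈ X, ∀ t ∈ Set.Icc (0:ℝ) 1, (1 - t) • x ∈ X)
    (h0X : (0 : EuclideanSpace ℝ (Fin n)) ∈ X)
    (f : EuclideanSpace ℝ (Fin n) → ℝ) (hf : ContDiffOn ℝ (⊤ : ℕ∞) f V)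
    (hpart : ∀ i : Fin n,
      JInf X V (fun x => fderivWithin ℝ f V x (EuclideanSpace.single i 1))) :
    JInf X V (fun x => f x - f 0) := by
  have hflat : ∀ k : ℕ, ∀ x ∈ X, iteratedFDerivWithin ℝ k (fderivWithin ℝ f V) V x = 0 :=
    fun k x hx => iteratedFDerivWithin_eq_zero_of_apply_single hV
      (hf.fderivWithin hV.uniqueDiffOn (by simp)) (hXV hx) k fun i => (hpart i).2 k x hx
  have hderiv : ∀ x ∈ X, fderivWithin ℝ f V x = 0 := fun x hx => by
    have h := congrArg (fun M => M 0) (hflat 0 x hx)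
    simpa using h
  refine ⟨hf.sub contDiffOn_const, fun k x hx => ?_⟩
  cases k with
  | zero =>
    have hseg : segment ℝ 0 x ⊆ X := by
      rw [segment_eq_image]
      rintro _ ⟨t, ht, rfl⟩
      have := hstar x hx (1 - t) ⟨by linarith [ht.2], by linarith [ht.1]⟩
      simpa using this
    have hle := (convex_segment (𝕜 := ℝ) (0 : EuclideanSpace ℝ (Fin n)) x
      ).norm_image_sub_le_of_norm_hasFDerivWithin_le (f := f) (C := 0)
      (f' := fun y => fderivWithin ℝ f V y)
      (fun y hy => ((hf.differentiableOn (by simp) y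
        (hXV (hseg hy))).hasFDerivWithinAt).mono (hseg.trans hXV))
      (fun y hy => by simp [hderiv y (hseg hy)])
      (left_mem_segment ℝ 0 x) (right_mem_segment ℝ 0 x)
    have heq : f x - f 0 = 0 := by simpa using hle
    ext m
    simpa using heq
  | succ k =>
    have hfd : fderivWithin ℝ (fun y => f y - f 0) V = fderivWithin ℝ f V := by
      ext1 y
      exact fderivWithin_sub_const _
    rw [iteratedFDerivWithin_succ_eq_comp_right hV.uniqueDiffOn (hXV hx), hfd,
      Function.comp_apply, hflat k x hx, LinearIsometryEquiv.map_zero]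
end
end

section
/- Let U ⊆ ℝⁿ be open, X ⊆ U relatively closed and nonempty, and f ∈ 𝒥^∞(X,U). Then for every compact set K ⊆ U, every multi-index α ∈ ℕⁿ, and every k ∈ ℕ, there exists a constant C > 0 such that |∂^α f(y)| ≤ C · dist(y, X)^k for all y ∈ K. -/
noncomputable section

/-- If the `m`-th derivative of a smooth function vanishes at a point `x` of a convex set `S`, then
at `z ∈ S` it is bounded by `‖z - x‖` times any bound for the next derivative on the points of `S`
that are at most as far from `x` as `z`. -/
theorem norm_iteratedFDerivWithin_le_of_flat {E F : Type*}
    [NormedAddCommGroup E] [NormedSpace ℝ E] [NormedAddCommGroup F] [NormedSpace ℝ F]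
    {f : E → F} {U S : Set E} (hf : ContDiffOn ℝ (⊤ : ℕ∞) f U) (hU : IsOpen U)
    (hS : Convex ℝ S) (hSU : S ⊆ U) {x z : E} (hx : x ∈ S) (hz : z ∈ S) {m : ℕ}
    (hflat : iteratedFDerivWithin ℝ m f U x = 0) {B : ℝ}
    (hB : ∀ w ∈ S, dist w x ≤ dist z x → ‖iteratedFDerivWithin ℝ (m + 1) f U w‖ ≤ B) :
    ‖iteratedFDerivWithin ℝ m f U z‖ ≤ B * ‖z - x‖ := by
  have hdiff : DifferentiableOn ℝ (iteratedFDerivWithin ℝ m f U) U :=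
    hf.differentiableOn_iteratedFDerivWithin (by exact_mod_cast ENat.natCast_lt_top m)
      hU.uniqueDiffOn
  have key := (hS.inter (convex_closedBall x (dist z x))).norm_image_sub_le_of_norm_hasFDerivWithin_le
    (f := iteratedFDerivWithin ℝ m f U) (C := B)
    (fun w hw => (hdiff w (hSU hw.1)).hasFDerivWithinAt.mono
      (Set.inter_subset_left.trans hSU))
    (fun w hw => by
      rw [norm_fderivWithin_iteratedFDerivWithin]
      exact hB w hw.1 hw.2)
    ⟨hx, Metric.mem_closedBall_self dist_nonneg⟩ ⟨hz, Metric.mem_closedBall.2 le_rfl⟩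
  simpa [hflat] using key

/-- A function flat on `X` decays, together with all its derivatives, faster than any power of
the distance to `X`, uniformly on compact subsets of `U`. -/
theorem flat_decay_dist_pow {n : ℕ} (U X : Set (EuclideanSpace ℝ (Fin n)))
    (hU : IsOpen U) (hXU : X ⊆ U) (hrc : closure X ∩ U = X) (hne : X.Nonempty)
    (f : EuclideanSpace ℝ (Fin n) → ℝ) (hf : JInf X U f)
    (K : Set (EuclideanSpace ℝ (Fin n))) (hK : IsCompact K) (hKU : K ⊆ U) (m k : ℕ) :
    ∃ C > (0:ℝ), ∀ y ∈ K,
      ‖iteratedFDerivWithin ℝ m f U y‖ ≤ C * Metric.infDist y X ^ k := by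
  obtain ⟨hfs, hflat⟩ := hf
  obtain ⟨δ, hδ, hδU⟩ := hK.exists_cthickening_subset_open hU hKU
  have hLc : IsCompact (Metric.cthickening δ K) := hK.cthickening
  have hball : ∀ y ∈ K, Metric.ball y δ ⊆ Metric.cthickening δ K := fun y hy =>
    (Metric.ball_subset_thickening hy δ).trans (Metric.thickening_subset_cthickening δ K)
  have hbdd : ∀ m : ℕ, ∃ M : ℝ, ∀ z ∈ Metric.cthickening δ K,
      ‖iteratedFDerivWithin ℝ m f U z‖ ≤ M := fun m =>
    hLc.exists_bound_of_continuousOn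
      ((hfs.continuousOn_iteratedFDerivWithin (by exact_mod_cast le_top) hU.uniqueDiffOn).mono hδU)
  have hlocal : ∀ k m : ℕ, ∃ C : ℝ, ∀ y ∈ K, ∀ x ∈ X ∩ Metric.ball y δ, ∀ z ∈ Metric.ball y δ,
      ‖iteratedFDerivWithin ℝ m f U z‖ ≤ C * dist z x ^ k := by
    intro k
    induction k with
    | zero =>
      intro m
      obtain ⟨M, hM⟩ := hbdd m
      exact ⟨M, fun y hy x _ z hz => by simpa using hM z (hball y hy hz)⟩
    | succ k ih =>
      intro m
      obtain ⟨C, hC⟩ := ih (m + 1)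
      refine ⟨|C|, fun y hy x hx z hz => ?_⟩
      rw [pow_succ, ← mul_assoc, dist_eq_norm z x]
      exact norm_iteratedFDerivWithin_le_of_flat hfs hU
        (convex_ball y δ) ((hball y hy).trans hδU) hx.2 hz (hflat m x hx.1)
        fun w hw hwz => (hC y hy x hx w hw).trans <| by
          rw [← dist_eq_norm]
          gcongr
          exact le_abs_self C
  obtain ⟨M, hM⟩ := hbdd m
  obtain ⟨C, hC⟩ := hlocal k m
  refine ⟨|C| + |M| / δ ^ k + 1, by positivity, fun y hy => ?_⟩
  have hd : 0 ≤ Metric.infDist y X := Metric.infDist_nonneg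
  rcases lt_or_ge (Metric.infDist y X) δ with hlt | hge
  · obtain ⟨x, hx, hxd⟩ := isClosed_closure.exists_infDist_eq_dist hne.closure y
    rw [Metric.infDist_closure] at hxd
    have hxb : x ∈ Metric.ball y δ := by
      rw [Metric.mem_ball, dist_comm, ← hxd]
      exact hlt
    have hxX : x ∈ X := hrc ▸ ⟨hx, hδU (hball y hy hxb)⟩
    refine (hC y hy x ⟨hxX, hxb⟩ y (Metric.mem_ball_self hδ)).trans ?_
    rw [← hxd]
    gcongr
    have : 0 ≤ |M| / δ ^ k := by positivity
    linarith [le_abs_self C]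
  · calc ‖iteratedFDerivWithin ℝ m f U y‖ ≤ |M| :=
          (hM y (hball y hy (Metric.mem_ball_self hδ))).trans (le_abs_self M)
      _ = |M| / δ ^ k * δ ^ k := by field_simp
      _ ≤ (|C| + |M| / δ ^ k + 1) * Metric.infDist y X ^ k := by
          gcongr
          linarith [abs_nonneg C]
end
end

section
/- Let X ⊆ ℝⁿ be locally closed, and let U₁, U₂ ⊆ ℝⁿ be open sets such that X is relatively closed in U₁ and in U₂ (hence X ⊆ U₁ ∩ U₂ and X is relatively closed in U₁ ∩ U₂). Then for i = 1, 2, the restriction map C^∞(U_i,ℝ) → C^∞(U₁ ∩ U₂,ℝ) descends to an ℝ-algebra isomorphism C^∞(U_i,ℝ)/𝒥^∞(X,U_i) ≅ C^∞(U₁ ∩ U₂,ℝ)/𝒥^∞(X, U₁ ∩ U₂). In particular, the algebra of Whitney functions C^∞(U,ℝ)/𝒥^∞(X,U) is, up to isomorphism, independent of the choice of the open set U in which X is relatively closed. -/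
noncomputable section

/-- On an open set, flatness only depends on the derivatives taken in the whole space. -/
theorem jInf_iff_of_isOpen {n : ℕ} {X U : Set (EuclideanSpace ℝ (Fin n))} (hU : IsOpen U)
    (hXU : X ⊆ U) {f : EuclideanSpace ℝ (Fin n) → ℝ} :
    JInf X U f ↔ ContDiffOn ℝ (⊤ : ℕ∞) f U ∧ ∀ k : ℕ, ∀ x ∈ X, iteratedFDeriv ℝ k f x = 0 :=
  and_congr_right fun _ => forall_congr' fun k => forall₂_congr fun _ hx => by
    rw [iteratedFDerivWithin_of_isOpen k hU (hXU hx)]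

/-- A smooth function on a neighbourhood `V` of a relatively closed subset `X` of an open set `U`
agrees near `X` with a smooth function on `U`. -/
theorem exists_contDiffOn_eventuallyEq {E : Type*} [NormedAddCommGroup E] [NormedSpace ℝ E]
    [FiniteDimensional ℝ E] {X U V : Set E} (hV : IsOpen V) (hXV : X ⊆ V)
    (hX : closure X ∩ U ⊆ X) {g : E → ℝ} (hg : ContDiffOn ℝ (⊤ : ℕ∞) g V) :
    ∃ f : E → ℝ, ContDiffOn ℝ (⊤ : ℕ∞) f U ∧ ∀ x ∈ X ∩ U, f =ᶠ[nhds x] g := by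
  rcases X.eq_empty_or_nonempty with rfl | hXne
  · exact ⟨0, contDiffOn_const, by simp⟩
  rcases (U \ V).eq_empty_or_nonempty with hUV | hne
  · exact ⟨g, hg.mono (Set.sdiff_eq_empty.mp hUV), fun _ _ => .rfl⟩
  set a : E → ℝ := fun x => Metric.infDist x X
  set b : E → ℝ := fun x => Metric.infDist x (U \ V)
  have ha : Continuous a := Metric.continuous_infDist_pt X
  have hb : Continuous b := Metric.continuous_infDist_pt (U \ V)
  have ha0 (x) : 0 ≤ a x := Metric.infDist_nonneg
  have hb0 (x) : 0 ≤ b x := Metric.infDist_nonneg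
  have haX {x} (hx : x ∈ U) (h : a x = 0) : x ∈ X :=
    hX ⟨(Metric.mem_closure_iff_infDist_zero hXne).mpr h, hx⟩
  have hbV {x} (hx : x ∈ V) : 0 < b x := by
    refine (hb0 x).lt_of_ne' fun h => ?_
    have hcl : closure (U \ V) ⊆ Vᶜ :=
      closure_minimal (fun y hy => hy.2) hV.isClosed_compl
    exact hcl ((Metric.mem_closure_iff_infDist_zero hne).mpr h) hx
  obtain ⟨p, hp, hpc, hpr⟩ :=
    (isOpen_lt ha (hb.const_mul 2)).exists_contDiff_support_eq (n := (⊤ : ℕ∞))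
  obtain ⟨q, hq, hqc, hqr⟩ :=
    (isOpen_lt hb (ha.const_mul 2)).exists_contDiff_support_eq (n := (⊤ : ℕ∞))
  have hp_nonneg (x) : 0 ≤ p x := (hpr ⟨x, rfl⟩).1
  have hq_nonneg (x) : 0 ≤ q x := (hqr ⟨x, rfl⟩).1
  have hp0 (x) : p x = 0 ↔ 2 * b x ≤ a x := by
    rw [← Function.notMem_support, hp]; simp
  have hq0 (x) : q x = 0 ↔ 2 * a x ≤ b x := by
    rw [← Function.notMem_support, hq]; simp
  have hpq {x} (hx : x ∈ U) : p x + q x ≠ 0 := by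
    intro h
    have h1 := (hp0 x).mp (by linarith [hp_nonneg x, hq_nonneg x])
    have h2 := (hq0 x).mp (by linarith [hp_nonneg x, hq_nonneg x])
    have := hbV (hXV (haX hx (by linarith [ha0 x, hb0 x])))
    linarith [ha0 x]
  refine ⟨fun x => p x / (p x + q x) * g x, fun x hx => ?_, fun x hx => ?_⟩
  · by_cases hxV : x ∈ V
    · exact ((hpc.contDiffAt.div (hpc.contDiffAt.add hqc.contDiffAt) (hpq hx)).mul
        (hg.contDiffAt (hV.mem_nhds hxV))).contDiffWithinAt
    · have hbx : b x = 0 := Metric.infDist_zero_of_mem ⟨hx, hxV⟩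
      have hax : 0 < a x := (ha0 x).lt_of_ne' fun h => hxV (hXV (haX hx h))
      have hev : ∀ᶠ y in nhds x, 2 * b y < a y :=
        (hb.const_mul 2).continuousAt.eventually_lt ha.continuousAt (by linarith)
      have h0 : (fun y => p y / (p y + q y) * g y) =ᶠ[nhds x] fun _ => 0 := by
        filter_upwards [hev] with y hy
        simp [(hp0 y).mpr hy.le]
      exact (contDiffAt_const.congr_of_eventuallyEq h0).contDiffWithinAt
  · have hax : a x = 0 := Metric.infDist_zero_of_mem hx.1
    have hbx : 0 < b x := hbV (hXV hx.1)
    have hev : ∀ᶠ y in nhds x, 2 * a y < b y :=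
      (ha.const_mul 2).continuousAt.eventually_lt hb.continuousAt (by linarith)
    filter_upwards [hev] with y hy
    have hpy : p y ≠ 0 := fun h => by
      linarith [(hp0 y).mp h, ha0 y, hb0 y]
    simp [(hq0 y).mpr hy.le, hpy]

/-- The algebra of Whitney functions `C^∞(U)/𝒥^∞(X, U)` does not depend on the choice of the
open set `U` in which `X` is relatively closed: for `i = 1, 2` the restriction map
`C^∞(Uᵢ) → C^∞(U₁ ∩ U₂)` descends to an isomorphism
`C^∞(Uᵢ)/𝒥^∞(X, Uᵢ) ≅ C^∞(U₁ ∩ U₂)/𝒥^∞(X, U₁ ∩ U₂)`; concretely, restriction preserves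
smoothness, a smooth function on `Uᵢ` is flat on `X` relative to `U₁ ∩ U₂` iff it is flat
relative to `Uᵢ` (injectivity), and every smooth function on `U₁ ∩ U₂` agrees, modulo the flat
ideal, with a smooth function on `Uᵢ` (surjectivity). -/
theorem whitney_algebra_independent_of_nbhd {n : ℕ} (X U₁ U₂ : Set (EuclideanSpace ℝ (Fin n)))
    (hU₁ : IsOpen U₁) (hU₂ : IsOpen U₂) (hlc : IsLocallyClosed X)
    (hX1 : X ⊆ U₁) (hX2 : X ⊆ U₂)
    (hrc1 : closure X ∩ U₁ = X) (hrc2 : closure X ∩ U₂ = X) :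
    ∀ U ∈ ({U₁, U₂} : Set (Set (EuclideanSpace ℝ (Fin n)))),
      (∀ f : EuclideanSpace ℝ (Fin n) → ℝ,
        ContDiffOn ℝ (⊤ : ℕ∞) f U → ContDiffOn ℝ (⊤ : ℕ∞) f (U₁ ∩ U₂)) ∧
      (∀ f : EuclideanSpace ℝ (Fin n) → ℝ, ContDiffOn ℝ (⊤ : ℕ∞) f U →
        (JInf X (U₁ ∩ U₂) f ↔ JInf X U f)) ∧
      (∀ g : EuclideanSpace ℝ (Fin n) → ℝ, ContDiffOn ℝ (⊤ : ℕ∞) g (U₁ ∩ U₂) →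
        ∃ f : EuclideanSpace ℝ (Fin n) → ℝ, ContDiffOn ℝ (⊤ : ℕ∞) f U ∧
          JInf X (U₁ ∩ U₂) (fun x => f x - g x)) := by
  have key : ∀ U : Set (EuclideanSpace ℝ (Fin n)), IsOpen U → U₁ ∩ U₂ ⊆ U → X ⊆ U →
      closure X ∩ U = X →
      (∀ f : EuclideanSpace ℝ (Fin n) → ℝ,
        ContDiffOn ℝ (⊤ : ℕ∞) f U → ContDiffOn ℝ (⊤ : ℕ∞) f (U₁ ∩ U₂)) ∧
      (∀ f : EuclideanSpace ℝ (Fin n) → ℝ, ContDiffOn ℝ (⊤ : ℕ∞) f U →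
        (JInf X (U₁ ∩ U₂) f ↔ JInf X U f)) ∧
      (∀ g : EuclideanSpace ℝ (Fin n) → ℝ, ContDiffOn ℝ (⊤ : ℕ∞) g (U₁ ∩ U₂) →
        ∃ f : EuclideanSpace ℝ (Fin n) → ℝ, ContDiffOn ℝ (⊤ : ℕ∞) f U ∧
          JInf X (U₁ ∩ U₂) (fun x => f x - g x)) := by
    intro U hU hVU hXU hrc
    have hV := hU₁.inter hU₂
    have hXV : X ⊆ U₁ ∩ U₂ := Set.subset_inter hX1 hX2
    refine ⟨fun f hf => hf.mono hVU, fun f hf => ?_, fun g hg => ?_⟩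
    · rw [jInf_iff_of_isOpen hV hXV, jInf_iff_of_isOpen hU hXU]
      simp only [hf, hf.mono hVU, true_and]
    · obtain ⟨f, hf, hfg⟩ := exists_contDiffOn_eventuallyEq hV hXV hrc.subset hg
      refine ⟨f, hf, (jInf_iff_of_isOpen hV hXV).mpr ⟨(hf.mono hVU).sub hg, fun k x hx => ?_⟩⟩
      have h0 : (fun y => f y - g y) =ᶠ[nhds x] 0 := by
        filter_upwards [hfg x ⟨hx, hXU hx⟩] with y hy
        simp [hy]
      rw [(h0.iteratedFDeriv ℝ k).eq_of_nhds]
      simp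
  rintro U (rfl | rfl)
  · exact key U hU₁ Set.inter_subset_left hX1 hrc1
  · exact key U hU₂ Set.inter_subset_right hX2 hrc2
end
end

section
/- Let U ⊆ ℝⁿ be open, X ⊆ U relatively closed, and let (W_i)_{i ∈ I} be an open cover of U. Suppose given functions f_i ∈ C^∞(W_i,ℝ) such that for all i, j ∈ I the difference f_i − f_j restricted to W_i ∩ W_j belongs to 𝒥^∞(X ∩ W_i ∩ W_j, W_i ∩ W_j). Then there exists f ∈ C^∞(U,ℝ) such that for every i ∈ I the restriction of f − f_i to W_i belongs to 𝒥^∞(X ∩ W_i, W_i). (Gluing property: the presheaf of Whitney functions is a sheaf.) -/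
noncomputable section

open scoped ContDiff Manifold Topology

/-- A smooth partition of unity on an open set `U` subordinate to a cover of `U` by open sets,
described by functions on the ambient space: every point of `U` has a neighbourhood on which only
finitely many functions are nonzero, and their domains contain the point. -/
lemma exists_contDiffOn_partitionOfUnity {E : Type*} [NormedAddCommGroup E] [NormedSpace ℝ E]
    [FiniteDimensional ℝ E] {ι : Type*} {U : Set E} (hU : IsOpen U) {W : ι → Set E}
    (hW : ∀ i, IsOpen (W i)) (hcov : U ⊆ ⋃ i, W i) :
    ∃ r : ι → E → ℝ, (∀ i, ContDiffOn ℝ ∞ (r i) U) ∧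
      ∀ x ∈ U, ∃ J : Finset ι, (∀ j ∈ J, x ∈ W j) ∧
        ∀ᶠ y in 𝓝 x, (∀ j ∉ J, r j y = 0) ∧ ∑ j ∈ J, r j y = 1 := by
  classical
  let M : TopologicalSpace.Opens E := ⟨U, hU⟩
  have : ProperSpace E := FiniteDimensional.proper ℝ E
  have : LocallyCompactSpace M := hU.locallyCompactSpace
  obtain ⟨ρ, hρ⟩ := SmoothPartitionOfUnity.exists_isSubordinate (I := 𝓘(ℝ, E)) (M := M)
    isClosed_univ (fun i => ((↑) : M → E) ⁻¹' W i)
    (fun i => (hW i).preimage continuous_subtype_val) (by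
      intro x _
      simpa using hcov x.2)
  let r : ι → E → ℝ := fun i x => if h : x ∈ U then ρ i ⟨x, h⟩ else 0
  have hr : ∀ i (x : M), r i x = ρ i x := fun i x => dif_pos x.2
  refine ⟨r, fun i x hx => ?_, fun x hx => ?_⟩
  · have h1 : ContMDiffAt 𝓘(ℝ, E) 𝓘(ℝ, ℝ) ∞ (fun y : M => r i y) ⟨x, hx⟩ := by
      simp only [hr]
      exact (ρ i).contMDiff.contMDiffAt
    exact (contMDiffAt_iff_contDiffAt.1 (contMDiffAt_subtype_iff.1 h1)).contDiffWithinAt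
  · refine ⟨ρ.fintsupport ⟨x, hx⟩, fun j hj => hρ j ((ρ.mem_fintsupport_iff _ j).1 hj), ?_⟩
    have hmap := hU.isOpenEmbedding_subtypeVal.map_nhds_eq ⟨x, hx⟩
    simp only at hmap
    rw [← hmap, Filter.eventually_map]
    filter_upwards [ρ.eventually_finsupport_subset ⟨x, hx⟩] with y hy
    refine ⟨fun j hj => ?_, ?_⟩
    · rw [hr]
      by_contra h
      exact hj (hy ((ρ.mem_finsupport y).2 h))
    · simp only [hr]
      exact ρ.sum_finsupport' y (Set.mem_univ y) hy

/-- Multiplying a function that is flat at a point by a smooth function gives a flat function. -/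
lemma iteratedFDerivWithin_mul_eq_zero_of_flat {E : Type*} [NormedAddCommGroup E]
    [NormedSpace ℝ E] {r h : E → ℝ} {s : Set E} {x : E} (hs : UniqueDiffOn ℝ s) (hx : x ∈ s)
    (hr : ContDiffOn ℝ ∞ r s) (hh : ContDiffOn ℝ ∞ h s)
    (hflat : ∀ k, iteratedFDerivWithin ℝ k h s x = 0) (k : ℕ) :
    iteratedFDerivWithin ℝ k (fun y => r y * h y) s x = 0 := by
  have hle := norm_iteratedFDerivWithin_mul_le (n := k) hr hh hs hx (mod_cast le_top)
  simpa [hflat] using hle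

/-- Gluing property: given an open cover `(W i)` of `U` and smooth functions `f i` on `W i`
whose pairwise differences are flat on `X` over the overlaps, there is a single smooth function
`g` on `U` agreeing with each `f i` modulo the flat ideal over `W i`; i.e. the presheaf of
Whitney functions is a sheaf. -/
theorem whitney_functions_glue {n : ℕ} (U X : Set (EuclideanSpace ℝ (Fin n)))
    (hU : IsOpen U) (hXU : X ⊆ U) (hrc : closure X ∩ U = X)
    {ι : Type} (W : ι → Set (EuclideanSpace ℝ (Fin n)))
    (hW : ∀ i, IsOpen (W i)) (hWU : ∀ i, W i ⊆ U) (hcov : U = ⋃ i, W i)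
    (f : ι → EuclideanSpace ℝ (Fin n) → ℝ) (hf : ∀ i, ContDiffOn ℝ (⊤ : ℕ∞) (f i) (W i))
    (hcompat : ∀ i j, JInf (X ∩ W i ∩ W j) (W i ∩ W j) (fun x => f i x - f j x)) :
    ∃ g : EuclideanSpace ℝ (Fin n) → ℝ, ContDiffOn ℝ (⊤ : ℕ∞) g U ∧
      ∀ i, JInf (X ∩ W i) (W i) (fun x => g x - f i x) := by
  obtain ⟨r, hr, hloc⟩ := exists_contDiffOn_partitionOfUnity hU hW hcov.subset
  have hrAt : ∀ j, ∀ x ∈ U, ContDiffAt ℝ ∞ (r j) x :=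
    fun j x hx => (hr j).contDiffAt (hU.mem_nhds hx)
  have hfAt : ∀ j, ∀ x ∈ W j, ContDiffAt ℝ ∞ (f j) x :=
    fun j x hx => (hf j).contDiffAt ((hW j).mem_nhds hx)
  have hsum : ∀ (J : Finset ι) y, (∀ j ∉ J, r j y = 0) →
      ∑ᶠ j, r j y * f j y = ∑ j ∈ J, r j y * f j y := by
    refine fun J y hy => finsum_eq_sum_of_support_subset _ fun j hj => ?_
    by_contra hjJ
    exact hj (by simp [hy j hjJ])
  have hg : ContDiffOn ℝ ∞ (fun y => ∑ᶠ j, r j y * f j y) U := by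
    intro x hx
    obtain ⟨J, hJ, hev⟩ := hloc x hx
    have hs : ContDiffAt ℝ ∞ (fun y => ∑ j ∈ J, r j y * f j y) x :=
      ContDiffAt.sum fun j hj => (hrAt j x hx).mul (hfAt j x (hJ j hj))
    refine (hs.congr_of_eventuallyEq ?_).contDiffWithinAt
    filter_upwards [hev] with y hy using hsum J y hy.1
  refine ⟨_, hg, fun i => ⟨(hg.mono (hWU i)).sub (hf i), fun k x hx => ?_⟩⟩
  obtain ⟨J, hJ, hev⟩ := hloc x (hXU hx.1)
  have heq : (fun y => ∑ᶠ j, r j y * f j y - f i y) =ᶠ[𝓝 x]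
      fun y => ∑ j ∈ J, r j y * (f j y - f i y) := by
    filter_upwards [hev] with y hy
    simp only [hsum J y hy.1, mul_sub, Finset.sum_sub_distrib, ← Finset.sum_mul, hy.2, one_mul]
  have hsub : ∀ j ∈ J, ContDiffAt ℝ ∞ (fun y => f j y - f i y) x :=
    fun j hj => (hfAt j x (hJ j hj)).sub (hfAt i x hx.2)
  rw [iteratedFDerivWithin_of_isOpen k (hW i) hx.2, (heq.iteratedFDeriv ℝ k).eq_of_nhds,
    iteratedFDeriv_fun_sum_apply fun j hj =>
      ((hrAt j x (hXU hx.1)).mul (hsub j hj)).of_le (mod_cast le_top)]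
  refine Finset.sum_eq_zero fun j hj => ?_
  have hopen : IsOpen (W j ∩ W i) := (hW j).inter (hW i)
  have hx' : x ∈ W j ∩ W i := ⟨hJ j hj, hx.2⟩
  rw [← iteratedFDerivWithin_of_isOpen k hopen hx']
  exact iteratedFDerivWithin_mul_eq_zero_of_flat hopen.uniqueDiffOn hx'
    ((hr j).mono fun y hy => hWU j hy.1) (hcompat j i).1
    (fun m => (hcompat j i).2 m x ⟨⟨hx.1, hJ j hj⟩, hx.2⟩) k
end
end
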